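/- arXiv:2004.14318 — 4 statements merged into one kernel-verified Lean document; each statement's English description precedes it below -/
import Mathlib

section
/- Let n > 1. The number of monomials in the unique multilinear real polynomial representing BPM*_n, i.e. the number of graphs G ⊆ K_{n,n} with a*_G ≠ 0, satisfies (n!)² ≤ |{G ⊆ K_{n,n} : a*_G ≠ 0}| ≤ (n+2)^{2n+2}. -/
open Finset

/-- An edge set `E ⊆ {1,…,n}×{1,…,n}` contains a perfect matching. -/
def hasPM (n : ℕ) (E : Finset (Fin n × Fin n)) : Prop :=
  ∃ σ : Equiv.Perm (Fin n), ∀ i : Fin n, (i, σ i) ∈ E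

open scoped Classical in
/-- The Boolean dual of the bipartite perfect matching function: `1` iff the
complement of `E` contains no perfect matching, `0` otherwise. -/
noncomputable def bpmStar (n : ℕ) (E : Finset (Fin n × Fin n)) : ℝ :=
  if hasPM n (Finset.univ \ E) then 0 else 1

/-- The dual coefficient `a*_G` of a graph `G ⊆ K_{n,n}`:
`a*_G = Σ_{F ⊆ E(G)} (−1)^{|E(G)\F|} · BPM*_n(F)`. -/
noncomputable def dualCoeff (n : ℕ) (G : Finset (Fin n × Fin n)) : ℝ :=
  ∑ F ∈ G.powerset, (-1 : ℝ) ^ ((G \ F).card) * bpmStar n F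

/-- The bicliques `S ×ˢ T` with more than `n` vertices: the Hall obstructions to a perfect
matching in the complement. -/
def hallBicliques (n : ℕ) : Finset (Finset (Fin n × Fin n)) :=
  (Finset.univ.filter fun p : Finset (Fin n) × Finset (Fin n) => n < #p.1 + #p.2).image
    fun p => p.1 ×ˢ p.2

theorem mem_hallBicliques {n : ℕ} {B : Finset (Fin n × Fin n)} :
    B ∈ hallBicliques n ↔ ∃ S T : Finset (Fin n), n < #S + #T ∧ S ×ˢ T = B := by
  simp [hallBicliques]

theorem not_hasPM_compl_iff {n : ℕ} {F : Finset (Fin n × Fin n)} :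
    ¬ hasPM n (univ \ F) ↔ ∃ B ∈ hallBicliques n, B ⊆ F := by
  have hall : (∀ A : Finset (Fin n), #A ≤ #(univ.filter fun j => ∃ i ∈ A, (i, j) ∉ F)) ↔
      ∃ f : Fin n → Fin n, f.Injective ∧ ∀ i, (i, f i) ∉ F := by
    convert Fintype.all_card_le_filter_rel_iff_exists_injective (fun i j : Fin n => (i, j) ∉ F)
  have hpm : hasPM n (univ \ F) ↔ ∃ f : Fin n → Fin n, f.Injective ∧ ∀ i, (i, f i) ∉ F := by
    constructor
    · rintro ⟨σ, hσ⟩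
      exact ⟨σ, σ.injective, fun i => by simpa using hσ i⟩
    · rintro ⟨f, hf, h⟩
      exact ⟨Equiv.ofBijective f (Finite.injective_iff_bijective.1 hf), fun i => by simpa using h i⟩
  rw [hpm, ← hall]
  push Not
  constructor
  · rintro ⟨A, hA⟩
    refine ⟨_, mem_hallBicliques.2 ⟨A, (univ.filter fun j => ∃ i ∈ A, (i, j) ∉ F)ᶜ, ?_, rfl⟩, ?_⟩
    · rw [card_compl, Fintype.card_fin]
      have : #(univ.filter fun j => ∃ i ∈ A, (i, j) ∉ F) ≤ n := card_finset_fin_le _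
      omega
    · rintro ⟨i, j⟩ h
      simp only [mem_product, mem_compl, mem_filter_univ, not_exists, not_and, not_not] at h
      exact h.2 i h.1
  · rintro ⟨B, hB, hBF⟩
    obtain ⟨S, T, hST, rfl⟩ := mem_hallBicliques.1 hB
    refine ⟨S, ?_⟩
    have hsub : (univ.filter fun j => ∃ i ∈ S, (i, j) ∉ F) ⊆ Tᶜ := by
      intro j hj
      obtain ⟨i, hi, hij⟩ := (mem_filter_univ _).1 hj
      exact mem_compl.2 fun hjT => hij (hBF (mem_product.2 ⟨hi, hjT⟩))
    have hle := card_le_card hsub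
    rw [card_compl, Fintype.card_fin] at hle
    have := card_finset_fin_le T
    have := card_finset_fin_le S
    omega

theorem bpmStar_eq_sum {n : ℕ} (F : Finset (Fin n × Fin n)) :
    bpmStar n F = 1 - ∑ 𝓕 ∈ (hallBicliques n).powerset,
      (-1 : ℝ) ^ #𝓕 * if 𝓕.sup id ⊆ F then 1 else 0 := by
  classical
  have hprod : ∏ B ∈ hallBicliques n, (1 + (-1) * if B ⊆ F then (1 : ℝ) else 0) =
      ∑ 𝓕 ∈ (hallBicliques n).powerset, (-1 : ℝ) ^ #𝓕 * if 𝓕.sup id ⊆ F then 1 else 0 := by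
    rw [prod_one_add]
    refine sum_congr rfl fun 𝓕 _ => ?_
    rw [prod_mul_distrib, prod_const, prod_ite_zero]
    simp only [prod_const_one, Finset.sup_le_iff, id]
  rw [← hprod, bpmStar]
  by_cases h : hasPM n (univ \ F)
  · rw [if_pos h, prod_eq_one, sub_self]
    intro B hB
    rw [if_neg fun hBF => not_hasPM_compl_iff.2 ⟨B, hB, hBF⟩ h]
    simp
  · obtain ⟨B, hB, hBF⟩ := not_hasPM_compl_iff.1 h
    rw [if_neg h, prod_eq_zero hB (by simp [hBF]), sub_zero]

theorem sum_powerset_neg_one_pow_card_sdiff {α : Type*} [DecidableEq α] (U G : Finset α) :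
    ∑ F ∈ G.powerset, ((-1 : ℝ) ^ #(G \ F) * if U ⊆ F then 1 else 0) =
      if U = G then 1 else 0 := by
  by_cases hGU : G ⊆ U
  · rw [sum_eq_single G]
    · have hiff : U ⊆ G ↔ U = G := ⟨fun h => h.antisymm hGU, fun h => h.subset⟩
      simp [hiff]
    · intro F hF hFG
      rw [if_neg fun hUF => hFG ((mem_powerset.1 hF).antisymm (hGU.trans hUF)), mul_zero]
    · simp
  · rw [if_neg fun h => hGU h.ge]
    obtain ⟨e, heG, heU⟩ := not_subset.1 hGU
    obtain ⟨H, heH, rfl⟩ : ∃ H, e ∉ H ∧ G = insert e H :=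
      ⟨G.erase e, by simp, by simp [heG]⟩
    rw [sum_powerset_insert heH, ← sum_add_distrib]
    refine sum_eq_zero fun F hF => ?_
    have heF : e ∉ F := fun h => heH (mem_powerset.1 hF h)
    have hU : U ⊆ insert e F ↔ U ⊆ F := subset_insert_iff_of_notMem heU
    have hsd : insert e H \ insert e F = H \ F := by
      ext x; simp only [mem_sdiff, mem_insert]; grind
    rw [insert_sdiff_of_notMem _ heF, card_insert_of_notMem (by simp [heH]), hsd, pow_succ]
    simp only [hU]
    ring

theorem dualCoeff_eq_neg_sum {n : ℕ} {G : Finset (Fin n × Fin n)} (hG : G.Nonempty) :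
    dualCoeff n G =
      -∑ 𝓕 ∈ (hallBicliques n).powerset.filter (fun 𝓕 => 𝓕.sup id = G), (-1 : ℝ) ^ #𝓕 := by
  have h0 := sum_powerset_neg_one_pow_card_sdiff ∅ G
  simp only [empty_subset, if_true, mul_one, if_neg hG.ne_empty.symm] at h0
  simp only [dualCoeff, bpmStar_eq_sum, mul_sub, sum_sub_distrib, mul_one, h0, zero_sub, mul_sum]
  rw [sum_comm, sum_filter]
  congr 1
  refine sum_congr rfl fun 𝓕 _ => ?_
  simp only [mul_left_comm _ ((-1 : ℝ) ^ #𝓕)]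
  rw [← mul_sum, sum_powerset_neg_one_pow_card_sdiff, mul_ite, mul_one, mul_zero]

/-- A biclique through each of two edges inducing a matching: the pair can be uncrossed. -/
theorem exists_uncrossing {n : ℕ} {G B B' : Finset (Fin n × Fin n)} {i i' j j' : Fin n}
    (hne₁ : (i, j') ∉ G) (hne₂ : (i', j) ∉ G)
    (hB : B ∈ hallBicliques n) (hB' : B' ∈ hallBicliques n) (hBG : B ⊆ G) (hB'G : B' ⊆ G)
    (hBij : (i, j) ∈ B) (hBij' : (i', j') ∈ B') :
    ∃ C ∈ hallBicliques n, C ⊆ B ∪ B' ∧ (i, j) ∉ C ∧ (i', j') ∉ C := by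
  obtain ⟨S, T, hST, rfl⟩ := mem_hallBicliques.1 hB
  obtain ⟨S', T', hST', rfl⟩ := mem_hallBicliques.1 hB'
  rw [mem_product] at hBij hBij'
  have hi' : i' ∉ S := fun h => hne₂ (hBG (mem_product.2 ⟨h, hBij.2⟩))
  have hj' : j' ∉ T := fun h => hne₁ (hBG (mem_product.2 ⟨hBij.1, h⟩))
  have hi : i ∉ S' := fun h => hne₁ (hB'G (mem_product.2 ⟨h, hBij'.2⟩))
  have hj : j ∉ T' := fun h => hne₂ (hB'G (mem_product.2 ⟨hBij'.1, h⟩))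
  have hS := card_union_add_card_inter S S'
  have hT := card_union_add_card_inter T T'
  rcases lt_or_ge n (#(S ∪ S') + #(T ∩ T')) with h | h
  · refine ⟨_, mem_hallBicliques.2 ⟨_, _, h, rfl⟩, ?_, by simp [hj], by simp [hj']⟩
    rintro ⟨x, y⟩
    simp only [mem_product, mem_union, mem_inter]
    tauto
  · refine ⟨_, mem_hallBicliques.2 ⟨S ∩ S', T ∪ T', by omega, rfl⟩, ?_, by simp [hi], by simp [hi']⟩
    rintro ⟨x, y⟩
    simp only [mem_product, mem_union, mem_inter]
    tauto

theorem dualCoeff_eq_zero_of_induced_two_edges {n : ℕ} {G : Finset (Fin n × Fin n)}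
    {i i' j j' : Fin n} (hij : (i, j) ∈ G) (hmem' : (i', j') ∈ G)
    (hne₁ : (i, j') ∉ G) (hne₂ : (i', j) ∉ G) : dualCoeff n G = 0 := by
  classical
  rw [dualCoeff_eq_neg_sum ⟨_, hij⟩, neg_eq_zero]
  let P : Finset (Fin n × Fin n) → Prop := fun B => (i, j) ∈ B ∨ (i', j') ∈ B
  have key : ∀ 𝓕 ∈ (hallBicliques n).powerset.filter (fun 𝓕 => 𝓕.sup id = G),
      ∃ C ∈ hallBicliques n, C ⊆ (𝓕.filter P).sup id ∧ ¬ P C := by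
    intro 𝓕 h𝓕
    obtain ⟨hsub, hsup⟩ := mem_filter.1 h𝓕
    rw [mem_powerset] at hsub
    obtain ⟨B, hB, hBij⟩ := mem_sup.1 (hsup.symm ▸ hij)
    obtain ⟨B', hB', hBij'⟩ := mem_sup.1 (hsup.symm ▸ hmem')
    have hle : ∀ B ∈ 𝓕, B ⊆ G := fun B hB => hsup ▸ le_sup (f := id) hB
    obtain ⟨C, hC, hCs, h1, h2⟩ := exists_uncrossing hne₁ hne₂ (hsub hB) (hsub hB')
      (hle B hB) (hle B' hB') hBij hBij'
    refine ⟨C, hC, hCs.trans (union_subset ?_ ?_), by simp [P, h1, h2]⟩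
    · exact le_sup (f := id) (mem_filter.2 ⟨hB, Or.inl hBij⟩)
    · exact le_sup (f := id) (mem_filter.2 ⟨hB', Or.inr hBij'⟩)
  have choice : ∀ 𝓧 : Finset (Finset (Fin n × Fin n)), ∃ C,
      (∃ C ∈ hallBicliques n, C ⊆ 𝓧.sup id ∧ ¬ P C) →
        C ∈ hallBicliques n ∧ C ⊆ 𝓧.sup id ∧ ¬ P C := by
    intro 𝓧
    by_cases h : ∃ C ∈ hallBicliques n, C ⊆ 𝓧.sup id ∧ ¬ P C
    · obtain ⟨C, hC⟩ := h
      exact ⟨C, fun _ => hC⟩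
    · exact ⟨∅, fun h' => absurd h' h⟩
  choose c hc using choice
  have hc' := fun 𝓕 h𝓕 => hc (𝓕.filter P) (key 𝓕 h𝓕)
  let toggle : Finset (Finset (Fin n × Fin n)) → Finset (Finset (Fin n × Fin n)) :=
    fun 𝓕 => if c (𝓕.filter P) ∈ 𝓕 then 𝓕.erase (c (𝓕.filter P)) else insert (c (𝓕.filter P)) 𝓕
  have filter_toggle : ∀ 𝓕 ∈ (hallBicliques n).powerset.filter (fun 𝓕 => 𝓕.sup id = G),
      (toggle 𝓕).filter P = 𝓕.filter P := by
    intro 𝓕 h𝓕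
    have h := (hc' 𝓕 h𝓕).2.2
    ext B
    by_cases hm : c (𝓕.filter P) ∈ 𝓕
    · simp only [toggle, if_pos hm, mem_filter, mem_erase]
      exact ⟨fun hB => ⟨hB.1.2, hB.2⟩, fun hB => ⟨⟨fun e => h (e ▸ hB.2), hB.1⟩, hB.2⟩⟩
    · simp only [toggle, if_neg hm, mem_filter, mem_insert]
      exact ⟨fun hB => ⟨hB.1.resolve_left fun e => h (e ▸ hB.2), hB.2⟩,
        fun hB => ⟨Or.inr hB.1, hB.2⟩⟩
  refine sum_involution (fun 𝓕 _ => toggle 𝓕) ?_ ?_ ?_ ?_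
  · intro 𝓕 h𝓕
    by_cases hm : c (𝓕.filter P) ∈ 𝓕
    · simp only [toggle, if_pos hm]
      rw [← card_erase_add_one hm, pow_succ]
      ring
    · simp only [toggle, if_neg hm]
      rw [card_insert_of_notMem hm, pow_succ]
      ring
  · intro 𝓕 h𝓕 _ heq
    by_cases hm : c (𝓕.filter P) ∈ 𝓕
    · simp only [toggle, if_pos hm, erase_eq_self] at heq
      exact heq hm
    · simp only [toggle, if_neg hm, insert_eq_self] at heq
      exact hm heq
  · intro 𝓕 h𝓕
    obtain ⟨hCmem, hCsub, -⟩ := hc' 𝓕 h𝓕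
    have hft := filter_toggle 𝓕 h𝓕
    obtain ⟨hsub, hsup⟩ := mem_filter.1 h𝓕
    rw [mem_powerset] at hsub
    have hCG : c (𝓕.filter P) ⊆ G := by
      refine hCsub.trans ?_
      rw [← hsup]
      exact sup_mono (filter_subset _ _)
    refine mem_filter.2 ⟨mem_powerset.2 ?_, ?_⟩
    · by_cases hm : c (𝓕.filter P) ∈ 𝓕
      · simp only [toggle, if_pos hm]
        exact (erase_subset _ _).trans hsub
      · simp only [toggle, if_neg hm]
        exact insert_subset hCmem hsub
    · by_cases hm : c (𝓕.filter P) ∈ 𝓕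
      · have hCt : c (𝓕.filter P) ⊆ (toggle 𝓕).sup id :=
          hCsub.trans (hft ▸ sup_mono (filter_subset P (toggle 𝓕)))
        have hins : insert (c (𝓕.filter P)) (toggle 𝓕) = 𝓕 := by
          simp only [toggle, if_pos hm, insert_erase hm]
        rw [← hsup]
        nth_rewrite 2 [← hins]
        rw [sup_insert]
        exact (sup_eq_right.2 hCt).symm
      · simp only [toggle, if_neg hm, sup_insert, hsup]
        exact sup_eq_right.2 hCG
  · intro 𝓕 h𝓕
    have hft := filter_toggle 𝓕 h𝓕
    change (if c ((toggle 𝓕).filter P) ∈ toggle 𝓕 then (toggle 𝓕).erase (c ((toggle 𝓕).filter P))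
      else insert (c ((toggle 𝓕).filter P)) (toggle 𝓕)) = 𝓕
    rw [hft]
    by_cases hm : c (𝓕.filter P) ∈ 𝓕
    · simp only [toggle, if_pos hm]
      simp [insert_erase hm]
    · simp only [toggle, if_neg hm]
      simp [hm]

/-- A bipartite graph with no two edges inducing a matching is given by thresholds on vertices. -/
theorem exists_threshold_of_no_induced_two_edges {n : ℕ} {G : Finset (Fin n × Fin n)}
    (h : ∀ i i' j j' : Fin n, (i, j) ∈ G → (i', j') ∈ G → (i, j') ∈ G ∨ (i', j) ∈ G) :
    ∃ p : (Fin n → Fin (n + 2)) × (Fin n → Fin (n + 2)),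
      (univ.filter fun e : Fin n × Fin n => p.2 e.2 ≤ p.1 e.1) = G := by
  classical
  let N : Fin n → Finset (Fin n) := fun i => univ.filter fun j => (i, j) ∈ G
  have hN : ∀ i, #(N i) ≤ n := fun i => card_finset_fin_le _
  have threshold : ∀ j, ∃ m : Fin (n + 2), ∀ i, m.val ≤ #(N i) ↔ (i, j) ∈ G := by
    intro j
    rcases (univ.filter fun i => (i, j) ∈ G).eq_empty_or_nonempty with he | hne
    · refine ⟨Fin.last _, fun i => ?_⟩
      have hi : (i, j) ∉ G := fun hi => by
        have : i ∈ univ.filter fun i => (i, j) ∈ G := by simpa using hi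
        simp [he] at this
      have := hN i
      simp only [hi, iff_false, Fin.val_last]
      omega
    · obtain ⟨i₀, hi₀, hmin⟩ := exists_min_image _ (fun i => #(N i)) hne
      rw [mem_filter_univ] at hi₀
      refine ⟨⟨#(N i₀), by have := hN i₀; omega⟩, fun i => ⟨fun hle => ?_, fun hi => ?_⟩⟩
      · by_contra hi
        have hss : N i ⊂ N i₀ := by
          refine (ssubset_iff_of_subset fun k hk => ?_).2 ⟨j, by simp [N, hi₀], by simp [N, hi]⟩
          have hk' : (i, k) ∈ G := by simpa [N] using hk
          simpa [N] using (h i₀ i j k hi₀ hk').resolve_right hi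
        exact absurd (card_lt_card hss) (not_lt.2 hle)
      · exact hmin i (by simpa using hi)
  choose m hm using threshold
  refine ⟨(fun i => ⟨#(N i), by have := hN i; omega⟩, m), ?_⟩
  ext ⟨i, j⟩
  simp only [mem_filter_univ, Fin.le_def, hm]

/-- The staircase graph with rows ordered by `σ` and columns ordered by `τ`. -/
def staircase {n : ℕ} (σ τ : Equiv.Perm (Fin n)) : Finset (Fin n × Fin n) :=
  univ.filter fun e => τ e.2 ≤ (σ e.1).rev

theorem mem_staircase {n : ℕ} {σ τ : Equiv.Perm (Fin n)} {i j : Fin n} :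
    (i, j) ∈ staircase σ τ ↔ τ j ≤ (σ i).rev := by
  simp [staircase]

theorem card_filter_perm_le {n : ℕ} (σ : Equiv.Perm (Fin n)) (k : Fin n) :
    #(univ.filter fun i => σ i ≤ k) = k.val + 1 := by
  have h : (univ.filter fun i => σ i ≤ k) = (Iic k).map σ.symm.toEmbedding := by
    ext i
    simp [mem_map_equiv]
  rw [h, card_map, Fin.card_Iic]

theorem staircase_injective (n : ℕ) :
    Function.Injective fun p : Equiv.Perm (Fin n) × Equiv.Perm (Fin n) => staircase p.1 p.2 := by
  rintro ⟨σ, τ⟩ ⟨σ', τ'⟩ h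
  have hmem : ∀ i j, τ j ≤ (σ i).rev ↔ τ' j ≤ (σ' i).rev := fun i j => by
    rw [← mem_staircase, ← mem_staircase]
    exact Finset.ext_iff.1 h (i, j)
  refine Prod.ext (Equiv.ext fun i => Fin.rev_injective (Fin.ext ?_))
    (Equiv.ext fun j => Fin.rev_injective (Fin.ext ?_))
  · have h1 := card_filter_perm_le τ (σ i).rev
    simp only [hmem, card_filter_perm_le] at h1
    exact (Nat.succ.inj h1).symm
  · have h1 := card_filter_perm_le σ (τ j).rev
    simp only [Fin.le_rev_iff (i := σ _), hmem, ← Fin.le_rev_iff (i := σ' _),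
      card_filter_perm_le] at h1
    exact (Nat.succ.inj h1).symm

theorem eq_of_mem_hallBicliques_of_subset_staircase {n : ℕ} {σ τ : Equiv.Perm (Fin n)}
    {B : Finset (Fin n × Fin n)} (hB : B ∈ hallBicliques n) (hBG : B ⊆ staircase σ τ) :
    ∃ k, B = (univ.filter fun i => σ i ≤ k) ×ˢ (univ.filter fun j => τ j ≤ k.rev) := by
  obtain ⟨S, T, hST, rfl⟩ := mem_hallBicliques.1 hB
  have hSn := card_finset_fin_le S
  have hTn := card_finset_fin_le T
  obtain ⟨i, hi, himax⟩ := exists_max_image S σ (card_pos.1 (by omega))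
  obtain ⟨j, hj, hjmax⟩ := exists_max_image T τ (card_pos.1 (by omega))
  have hij := mem_staircase.1 (hBG (mem_product.2 ⟨hi, hj⟩))
  have hS : S ⊆ univ.filter fun x => σ x ≤ σ i := fun x hx => by simpa using himax x hx
  have hT : T ⊆ univ.filter fun y => τ y ≤ (σ i).rev :=
    fun y hy => by simpa using (hjmax y hy).trans hij
  have h1 := card_filter_perm_le σ (σ i)
  have h2 := card_filter_perm_le τ (σ i).rev
  have h3 := card_le_card hS
  have h4 := card_le_card hT
  have h5 := Fin.val_rev (σ i)
  have h6 := (σ i).isLt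
  refine ⟨σ i, ?_⟩
  rw [← eq_of_subset_of_card_le hS (by omega), ← eq_of_subset_of_card_le hT (by omega)]

theorem dualCoeff_staircase_ne_zero {n : ℕ} (hn : 0 < n) (σ τ : Equiv.Perm (Fin n)) :
    dualCoeff n (staircase σ τ) ≠ 0 := by
  have hne : (staircase σ τ).Nonempty :=
    ⟨(σ.symm ⟨0, hn⟩, τ.symm (Fin.rev ⟨0, hn⟩)), by simp [mem_staircase]⟩
  have hfilter : (hallBicliques n).powerset.filter (fun 𝓕 => 𝓕.sup id = staircase σ τ) =
      {(hallBicliques n).filter (· ⊆ staircase σ τ)} := by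
    refine eq_singleton_iff_unique_mem.2 ⟨mem_filter.2 ⟨?_, ?_⟩, fun 𝓕 h𝓕 => ?_⟩
    · simp
    · refine le_antisymm (Finset.sup_le fun B hB => (mem_filter.1 hB).2) ?_
      rintro ⟨i, j⟩ hij
      rw [mem_staircase] at hij
      refine mem_sup.2 ⟨(univ.filter fun x => σ x ≤ σ i) ×ˢ
        (univ.filter fun y => τ y ≤ (σ i).rev), mem_filter.2 ⟨?_, ?_⟩, by simp [hij]⟩
      · refine mem_hallBicliques.2 ⟨_, _, ?_, rfl⟩
        have := Fin.val_rev (σ i)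
        have := (σ i).isLt
        rw [card_filter_perm_le, card_filter_perm_le]
        omega
      · rintro ⟨x, y⟩ hxy
        simp only [mem_product, mem_filter_univ] at hxy
        exact mem_staircase.2 (hxy.2.trans (Fin.rev_le_rev.2 hxy.1))
    · obtain ⟨hsub, hsup⟩ := mem_filter.1 h𝓕
      rw [mem_powerset] at hsub
      have hle : ∀ B ∈ 𝓕, B ⊆ staircase σ τ := fun B hB => hsup ▸ le_sup (f := id) hB
      refine Subset.antisymm (fun B hB => mem_filter.2 ⟨hsub hB, hle B hB⟩) fun B hB => ?_
      obtain ⟨hB, hBG⟩ := mem_filter.1 hB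
      obtain ⟨k, rfl⟩ := eq_of_mem_hallBicliques_of_subset_staircase hB hBG
      have hcorner : (σ.symm k, τ.symm k.rev) ∈ staircase σ τ := by simp [mem_staircase]
      obtain ⟨B', hB', hmem⟩ := mem_sup.1 (hsup.symm ▸ hcorner)
      obtain ⟨m, rfl⟩ := eq_of_mem_hallBicliques_of_subset_staircase (hsub hB') (hle B' hB')
      simp only [id, mem_product, mem_filter_univ, Equiv.apply_symm_apply, Fin.rev_le_rev] at hmem
      rwa [le_antisymm hmem.1 hmem.2]
  rw [dualCoeff_eq_neg_sum hne, hfilter, sum_singleton]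
  simp

open scoped Classical in
/-- For `n > 1`, the number of monomials of the multilinear polynomial representing
`BPM*_n`, i.e. the number of graphs `G ⊆ K_{n,n}` with `a*_G ≠ 0`, lies between
`(n!)²` and `(n+2)^{2n+2}`. -/
theorem card_support_dual_polynomial (n : ℕ) (hn : 1 < n) :
    Nat.factorial n ^ 2 ≤
        ((Finset.univ : Finset (Finset (Fin n × Fin n))).filter
          (fun G => dualCoeff n G ≠ 0)).card ∧
      ((Finset.univ : Finset (Finset (Fin n × Fin n))).filter
          (fun G => dualCoeff n G ≠ 0)).card ≤ (n + 2) ^ (2 * n + 2) := by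
  constructor
  · calc Nat.factorial n ^ 2 =
          #(univ : Finset (Equiv.Perm (Fin n) × Equiv.Perm (Fin n))) := by
          rw [card_univ, Fintype.card_prod, Fintype.card_perm, Fintype.card_fin, sq]
      _ ≤ _ := card_le_card_of_injOn (fun p => staircase p.1 p.2)
          (fun p _ => by simpa using dualCoeff_staircase_ne_zero (by omega) p.1 p.2)
          (staircase_injective n).injOn
  · calc _ ≤ #((univ : Finset ((Fin n → Fin (n + 2)) × (Fin n → Fin (n + 2)))).image fun p =>
          univ.filter fun e : Fin n × Fin n => p.2 e.2 ≤ p.1 e.1) := by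
          refine card_le_card fun G hG => ?_
          rw [mem_filter_univ] at hG
          obtain ⟨p, hp⟩ := exists_threshold_of_no_induced_two_edges
            (fun i i' j j' hij hmem' => by
              by_contra! hnot
              exact hG (dualCoeff_eq_zero_of_induced_two_edges hij hmem' hnot.1 hnot.2))
          exact mem_image.2 ⟨p, mem_univ p, hp⟩
      _ ≤ (n + 2) ^ (2 * n) := by
          refine card_image_le.trans_eq ?_
          rw [card_univ, Fintype.card_prod, Fintype.card_fun, Fintype.card_fin, Fintype.card_fin]
          ring
      _ ≤ (n + 2) ^ (2 * n + 2) := Nat.pow_le_pow_right (by omega) (by omega)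
end

section
/- There exists a constant C > 0 such that for all n > 1 and all ε with 2^{−n·log₂ n} ≤ ε ≤ 1/3, the ε-approximate degree of the bipartite perfect matching function satisfies deg̃_ε(BPM_n) ≤ C · n^{3/2} · √(log n). -/
/-- The `ε`-approximate degree of a Boolean function `f : {0,1}^ι → {0,1}`:
the least total degree of a real polynomial `p` with `|f(x) − p(x)| ≤ ε` for
every `x ∈ {0,1}^ι`. -/
noncomputable def apxDeg (ι : Type) [Fintype ι] (f : (ι → Bool) → Bool) (ε : ℝ) : ℕ :=
  sInf {d : ℕ | ∃ p : MvPolynomial ι ℝ, p.totalDegree = d ∧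
    ∀ x : ι → Bool, |(if f x then (1 : ℝ) else 0) -
      MvPolynomial.eval (fun i => if x i then (1 : ℝ) else 0) p| ≤ ε}

/-- The bipartite perfect matching function `BPM_n : {0,1}^{n²} → {0,1}`: it outputs
`1` iff the selected edge set contains a perfect matching. -/
def BPM (n : ℕ) (x : Fin n × Fin n → Bool) : Bool :=
  decide (∃ σ : Equiv.Perm (Fin n), ∀ i : Fin n, x (i, σ i) = true)

open scoped Finset

/-! ### Univariate polynomials that are `1` at `0` and small at `1, …, N` -/

theorem Polynomial.Chebyshev.one_add_sq_mul_le_eval_T (n : ℕ) {x : ℝ} (hx : 1 ≤ x) :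
    1 + (n : ℝ) ^ 2 * (x - 1) ≤ (Polynomial.Chebyshev.T ℝ n).eval x := by
  have key : ∀ n : ℕ, 1 + (n : ℝ) ^ 2 * (x - 1) ≤ (Polynomial.Chebyshev.T ℝ n).eval x ∧
      (2 * (n : ℝ) + 1) * (x - 1) ≤ (Polynomial.Chebyshev.T ℝ (n + 1 : ℕ)).eval x -
        (Polynomial.Chebyshev.T ℝ n).eval x := by
    intro n
    induction n with
    | zero => simp
    | succ n ih =>
      obtain ⟨h1, h2⟩ := ih
      have h3 : 1 + ((n + 1 : ℕ) : ℝ) ^ 2 * (x - 1) ≤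
          (Polynomial.Chebyshev.T ℝ (n + 1 : ℕ)).eval x := by
        push_cast at h2 ⊢
        nlinarith
      refine ⟨h3, ?_⟩
      have h4 : (Polynomial.Chebyshev.T ℝ (n + 1 + 1 : ℕ)).eval x =
          2 * x * (Polynomial.Chebyshev.T ℝ (n + 1 : ℕ)).eval x -
            (Polynomial.Chebyshev.T ℝ n).eval x := by
        have := Polynomial.Chebyshev.T_add_two ℝ n
        push_cast
        rw [add_assoc, one_add_one_eq_two, this]
        simp
      have h5 : 1 ≤ (Polynomial.Chebyshev.T ℝ (n + 1 : ℕ)).eval x :=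
        le_trans (by nlinarith [sq_nonneg ((n + 1 : ℕ) : ℝ)]) h3
      rw [h4]
      push_cast at h2 h5 ⊢
      nlinarith [mul_nonneg (sub_nonneg.2 hx) (sub_nonneg.2 h5)]
  exact (key n).1

theorem Polynomial.natDegree_comp_linear_le (p : Polynomial ℝ) (a b : ℝ) :
    (p.comp (Polynomial.C a + Polynomial.C b * Polynomial.X)).natDegree ≤ p.natDegree := by
  refine Polynomial.natDegree_comp_le.trans ?_
  have : (Polynomial.C a + Polynomial.C b * Polynomial.X).natDegree ≤ 1 := by
    compute_degree
  nlinarith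

theorem Polynomial.Chebyshev.natDegree_T_natCast (d : ℕ) :
    (Polynomial.Chebyshev.T ℝ d).natDegree = d := by
  simp

/-- A low-degree polynomial bounded by `1` on `[0, N]` which is `1` at `0` and vanishes at `i`. -/
theorem exists_polynomial_root_abs_le_one (N i d : ℕ) (hi : 0 < i) (hd : 0 < d)
    (h : N ≤ d ^ 2 * i) :
    ∃ p : Polynomial ℝ, p.natDegree ≤ d ∧ p.eval 0 = 1 ∧ p.eval (i : ℝ) = 0 ∧
      ∀ x : ℝ, 0 ≤ x → x ≤ N → |p.eval x| ≤ 1 := by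
  have hd' : (0 : ℝ) < d := by exact_mod_cast hd
  have hi' : (0 : ℝ) < i := by exact_mod_cast hi
  set θ : ℝ := Real.pi / (2 * d) with hθ
  set c : ℝ := (1 - Real.cos θ) / i with hc
  have hc0 : 0 ≤ c := div_nonneg (by linarith [Real.cos_le_one θ]) hi'.le
  have hcN : c * N ≤ 2 := by
    have h1 : 1 - Real.cos θ ≤ θ ^ 2 / 2 := by linarith [Real.one_sub_sq_div_two_le_cos (x := θ)]
    have h2 : θ ^ 2 / 2 * d ^ 2 ≤ 2 := by
      rw [hθ]
      field_simp
      nlinarith [Real.pi_lt_four, Real.pi_pos]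
    have h3 : (N : ℝ) ≤ d ^ 2 * i := by exact_mod_cast h
    calc c * N ≤ c * (d ^ 2 * i) := by gcongr
      _ = (1 - Real.cos θ) * d ^ 2 := by rw [hc]; field_simp
      _ ≤ θ ^ 2 / 2 * d ^ 2 := by gcongr
      _ ≤ 2 := h2
  refine ⟨(Polynomial.Chebyshev.T ℝ d).comp
    (Polynomial.C 1 + Polynomial.C (-c) * Polynomial.X), ?_, ?_, ?_, ?_⟩
  · exact (Polynomial.natDegree_comp_linear_le _ _ _).trans
      (Polynomial.Chebyshev.natDegree_T_natCast d).le
  · simp [Polynomial.eval_comp]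
  · have : 1 + -c * (i : ℝ) = Real.cos θ := by rw [hc]; field_simp; ring
    rw [Polynomial.eval_comp]
    simp only [Polynomial.eval_add, Polynomial.eval_C, Polynomial.eval_mul, Polynomial.eval_X]
    rw [this, Polynomial.Chebyshev.T_real_cos]
    have : ((d : ℤ) : ℝ) * θ = Real.pi / 2 := by rw [hθ]; push_cast; field_simp
    rw [this, Real.cos_pi_div_two]
  · intro x hx0 hxN
    rw [Polynomial.eval_comp]
    apply Polynomial.Chebyshev.abs_eval_T_real_le_one
    simp only [Polynomial.eval_add, Polynomial.eval_C, Polynomial.eval_mul, Polynomial.eval_X]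
    have := mul_le_mul_of_nonneg_left hxN hc0
    have := mul_nonneg hc0 hx0
    rw [abs_le]
    constructor <;> linarith

theorem le_ceil_sqrt_div_sq_mul (N i : ℕ) (hi : 0 < i) :
    N ≤ ⌈√((N : ℝ) / i)⌉₊ ^ 2 * i := by
  have hi' : (0 : ℝ) < i := by exact_mod_cast hi
  have h2 : (N : ℝ) / i ≤ (⌈√((N : ℝ) / i)⌉₊ : ℝ) ^ 2 :=
    (Real.sqrt_le_left (by positivity)).1 (Nat.le_ceil _)
  rw [div_le_iff₀ hi'] at h2
  exact_mod_cast h2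

/-- A polynomial bounded by `1` on `[0, N]`, equal to `1` at `0` and vanishing at `1, …, r`. -/
theorem exists_polynomial_roots_abs_le_one (N r : ℕ) (hN : 0 < N) :
    ∃ p : Polynomial ℝ, (p.natDegree : ℝ) ≤ r + 2 * √((N : ℝ) * r) ∧ p.eval 0 = 1 ∧
      (∀ i : ℕ, 0 < i → i ≤ r → p.eval (i : ℝ) = 0) ∧
      ∀ x : ℝ, 0 ≤ x → x ≤ N → |p.eval x| ≤ 1 := by
  induction r with
  | zero => exact ⟨1, by simp, by simp, by intro i h1 h2; omega, by simp⟩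
  | succ r ih =>
    obtain ⟨p, hp1, hp2, hp3, hp4⟩ := ih
    have hN' : (0 : ℝ) < N := by exact_mod_cast hN
    have hs : 0 < √((N : ℝ) / (r + 1 : ℕ)) := Real.sqrt_pos.2 (by positivity)
    obtain ⟨q, hq1, hq2, hq3, hq4⟩ := exists_polynomial_root_abs_le_one N (r + 1)
      ⌈√((N : ℝ) / (r + 1 : ℕ))⌉₊ r.succ_pos (Nat.ceil_pos.2 hs)
      (le_ceil_sqrt_div_sq_mul N (r + 1) r.succ_pos)
    refine ⟨p * q, ?_, by simp [hp2, hq2], ?_, ?_⟩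
    · have h1 : ((p * q).natDegree : ℝ) ≤ p.natDegree + ⌈√((N : ℝ) / (r + 1 : ℕ))⌉₊ := by
        exact_mod_cast Polynomial.natDegree_mul_le.trans (by gcongr)
      have h2 := Nat.ceil_lt_add_one hs.le
      have h3 : √((N : ℝ) / (r + 1 : ℕ)) + 2 * √((N : ℝ) * r) ≤ 2 * √((N : ℝ) * (r + 1 : ℕ)) := by
        rw [Real.sqrt_div hN'.le, Real.sqrt_mul hN'.le, Real.sqrt_mul hN'.le]
        push_cast
        have ha : √(r : ℝ) ^ 2 = r := Real.sq_sqrt (by positivity)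
        have hb : √((r : ℝ) + 1) ^ 2 = r + 1 := Real.sq_sqrt (by positivity)
        have hb0 : 0 < √((r : ℝ) + 1) := Real.sqrt_pos.2 (by positivity)
        have hc0 : 0 < √(N : ℝ) := Real.sqrt_pos.2 hN'
        have hd : 1 + 2 * √(r : ℝ) * √((r : ℝ) + 1) ≤ 2 * √((r : ℝ) + 1) ^ 2 := by
          nlinarith [sq_nonneg (√(r : ℝ) - √((r : ℝ) + 1))]
        have he : √(N : ℝ) / √((r : ℝ) + 1) + 2 * (√(N : ℝ) * √(r : ℝ)) =
            √(N : ℝ) * (1 + 2 * √(r : ℝ) * √((r : ℝ) + 1)) / √((r : ℝ) + 1) := by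
          field_simp
        rw [he, div_le_iff₀ hb0]
        nlinarith
      push_cast at *
      linarith
    · intro i hi hir
      rcases Nat.lt_or_ge r i with h | h
      · obtain rfl : i = r + 1 := by omega
        simp only [Polynomial.eval_mul, hq3, mul_zero]
      · simp only [Polynomial.eval_mul, hp3 i hi h, zero_mul]
    · intro x h0 h1
      rw [Polynomial.eval_mul, abs_mul]
      exact mul_le_one₀ (hp4 x h0 h1) (abs_nonneg _) (hq4 x h0 h1)

/-- A low-degree polynomial that is `1` at `0` and at most `1 / 2` in absolute value on `[r, N]`. -/
theorem exists_polynomial_abs_le_half (N r : ℕ) (hr : 0 < r) (hN : 0 < N) :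
    ∃ p : Polynomial ℝ, (p.natDegree : ℝ) ≤ 1 + √((N : ℝ) / r) ∧ p.eval 0 = 1 ∧
      ∀ x : ℝ, r ≤ x → x ≤ N → |p.eval x| ≤ 1 / 2 := by
  have hN' : (0 : ℝ) < N := by exact_mod_cast hN
  have hr' : (0 : ℝ) < r := by exact_mod_cast hr
  set d : ℕ := ⌈√((N : ℝ) / r)⌉₊ with hd
  set τ : ℝ := (Polynomial.Chebyshev.T ℝ d).eval (1 + r / N) with hτ
  have hτ2 : 2 ≤ τ := by
    refine le_trans ?_ (Polynomial.Chebyshev.one_add_sq_mul_le_eval_T d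
      (le_add_of_nonneg_right (by positivity)))
    have h1 : (N : ℝ) ≤ d ^ 2 * r := by exact_mod_cast le_ceil_sqrt_div_sq_mul N r hr
    have h2 : (1 : ℝ) ≤ d ^ 2 * r / N := (one_le_div hN').2 h1
    have h3 : (d : ℝ) ^ 2 * (1 + r / N - 1) = d ^ 2 * r / N := by ring
    linarith
  refine ⟨Polynomial.C τ⁻¹ * (Polynomial.Chebyshev.T ℝ d).comp
    (Polynomial.C (1 + (r : ℝ) / N) + Polynomial.C (-(N : ℝ)⁻¹) * Polynomial.X), ?_, ?_, ?_⟩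
  · have h1 := (Polynomial.natDegree_C_mul_le τ⁻¹ _).trans
      ((Polynomial.natDegree_comp_linear_le (Polynomial.Chebyshev.T ℝ d)
        (1 + (r : ℝ) / N) (-(N : ℝ)⁻¹)).trans
      (Polynomial.Chebyshev.natDegree_T_natCast d).le)
    have h2 := Nat.ceil_lt_add_one (Real.sqrt_nonneg ((N : ℝ) / r))
    have h3 : (_ : ℝ) ≤ (d : ℝ) := Nat.cast_le.2 h1
    linarith
  · simp only [Polynomial.eval_mul, Polynomial.eval_comp, Polynomial.eval_add, Polynomial.eval_C,
      Polynomial.eval_X, mul_zero, add_zero]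
    exact inv_mul_cancel₀ (by linarith)
  · intro x h0 h1
    simp only [Polynomial.eval_mul, Polynomial.eval_comp, Polynomial.eval_add, Polynomial.eval_C,
      Polynomial.eval_X]
    have h2 : |1 + (r : ℝ) / N + -(N : ℝ)⁻¹ * x| ≤ 1 := by
      have e : 1 + (r : ℝ) / N + -(N : ℝ)⁻¹ * x = 1 - (x - r) / N := by field_simp; ring
      have h3 : 0 ≤ (x - r) / N := div_nonneg (by linarith) hN'.le
      have h4 : (x - r) / N ≤ 1 := (div_le_one hN').2 (by linarith)
      rw [e, abs_le]
      constructor <;> linarith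
    have h3 := Polynomial.Chebyshev.abs_eval_T_real_le_one d h2
    rw [abs_mul, abs_of_pos (inv_pos.2 (by linarith))]
    have h4 : τ⁻¹ ≤ 1 / 2 := by
      rw [one_div]
      exact inv_anti₀ two_pos hτ2
    exact (mul_le_of_le_one_right (inv_nonneg.2 (by linarith)) h3).trans h4

/-- The `AND` function has `2⁻ᴸ`-approximate degree `O(√(N L))`, in univariate form. -/
theorem exists_polynomial_abs_le_half_pow (N L : ℕ) (hN : 0 < N) (hL : 0 < L) :
    ∃ p : Polynomial ℝ, (p.natDegree : ℝ) ≤ 5 * √((N : ℝ) * L) ∧ p.eval 0 = 1 ∧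
      ∀ j : ℕ, 0 < j → j ≤ N → |p.eval (j : ℝ)| ≤ (1 / 2) ^ L := by
  have hN' : (0 : ℝ) < N := by exact_mod_cast hN
  have hL' : (0 : ℝ) < L := by exact_mod_cast hL
  rcases le_total N L with h | h
  · obtain ⟨p, hp1, hp2, hp3, -⟩ := exists_polynomial_roots_abs_le_one N N hN
    refine ⟨p, hp1.trans ?_, hp2, fun j h0 h1 => ?_⟩
    · have h' : (N : ℝ) ≤ L := by exact_mod_cast h
      have h1 : √((N : ℝ) * N) ≤ √((N : ℝ) * L) := Real.sqrt_le_sqrt (by gcongr)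
      rw [Real.sqrt_mul_self hN'.le] at *
      linarith
    · rw [hp3 j h0 h1]
      simp
  · obtain ⟨p, hp1, hp2, hp3, hp4⟩ := exists_polynomial_roots_abs_le_one N L hN
    obtain ⟨q, hq1, hq2, hq3⟩ := exists_polynomial_abs_le_half N L hL hN
    refine ⟨p * q ^ L, ?_, by simp [hp2, hq2], fun j h0 h1 => ?_⟩
    · have h1 : ((p * q ^ L).natDegree : ℝ) ≤ p.natDegree + L * q.natDegree := by
        exact_mod_cast Polynomial.natDegree_mul_le.trans
          (add_le_add_right Polynomial.natDegree_pow_le _)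
      have h' : (L : ℝ) ≤ N := by exact_mod_cast h
      have h2 : (L : ℝ) ≤ √((N : ℝ) * L) := by
        apply Real.le_sqrt_of_sq_le
        nlinarith
      have h3 : (L : ℝ) * √((N : ℝ) / L) = √((N : ℝ) * L) := by
        nth_rewrite 1 [← Real.sqrt_sq hL'.le]
        rw [← Real.sqrt_mul (by positivity)]
        congr 1
        field_simp
      have h4 : (L : ℝ) * q.natDegree ≤ L * (1 + √((N : ℝ) / L)) := by gcongr
      linarith
    · have h1' : (j : ℝ) ≤ N := by exact_mod_cast h1
      rcases le_total j L with hj | hj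
      · rw [Polynomial.eval_mul, hp3 j h0 hj]
        simp
      · rw [Polynomial.eval_mul, Polynomial.eval_pow, abs_mul, abs_pow]
        calc |p.eval (j : ℝ)| * |q.eval (j : ℝ)| ^ L ≤ 1 * (1 / 2) ^ L := by
              gcongr
              · exact hp4 j (by positivity) h1'
              · exact hq3 j (by exact_mod_cast hj) h1'
          _ = (1 / 2) ^ L := one_mul _

/-! ### Signed chain counts in a finite poset -/

/-- The signed count of the chains in `{a | Q a}` with a prescribed greatest element, given by its
recursion. -/
theorem exists_signed_chain_count {α : Type*} [Fintype α] [PartialOrder α] (Q : α → Prop) :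
    ∃ φ : α → ℝ, (∀ a, ¬ Q a → φ a = 0) ∧
      (open Classical in ∀ a, Q a → φ a = 1 - ∑ b with b < a, φ b) := by
  classical
  let F : (a : α) → ((b : α) → b < a → ℝ) → ℝ := fun a f =>
    if Q a then 1 - ∑ b : α, (if h : b < a then f b h else 0) else 0
  have wf : WellFounded (fun a b : α => a < b) := wellFounded_lt
  refine ⟨wf.fix F, fun a ha => ?_, fun a ha => ?_⟩
  · rw [wf.fix_eq]
    simp [F, ha]
  · rw [wf.fix_eq]
    simp [F, ha, Finset.sum_filter]

open Classical in
theorem sum_le_eq_one_of_signed_chain_count {α : Type*} [Fintype α] [PartialOrder α]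
    {φ : α → ℝ} {a : α} (h : φ a = 1 - ∑ b with b < a, φ b) : ∑ b with b ≤ a, φ b = 1 := by
  have : (Finset.univ.filter (fun b => b ≤ a)) =
      insert a (Finset.univ.filter (fun b => b < a)) := by
    ext b
    simp [le_iff_eq_or_lt]
  rw [this, Finset.sum_insert (by simp), h]
  ring

open Classical in
/-- A subset of a finite lattice that contains `x ⊓ m` for each of its elements `x`
has Euler characteristic `1`, as it is conically contractible: `x ≥ x ⊓ m ≤ m`. -/
theorem sum_signed_chain_count_eq_one {α : Type*} [Fintype α] [Lattice α] (Q : α → Prop)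
    (m : α) (hm : Q m) (hQ : ∀ x, Q x → Q (x ⊓ m)) (φ : α → ℝ)
    (hφ0 : ∀ a, ¬ Q a → φ a = 0) (hφ : ∀ a, Q a → φ a = 1 - ∑ b with b < a, φ b) :
    ∑ a, φ a = 1 := by
  obtain ⟨ψ, hψ0, hψ⟩ := exists_signed_chain_count (α := αᵒᵈ) (fun a => Q (OrderDual.ofDual a))
  have hφ1 : ∀ a, Q a → ∑ b with b ≤ a, φ b = 1 := fun a ha =>
    sum_le_eq_one_of_signed_chain_count (hφ a ha)
  have hψ1 : ∀ a, Q a → ∑ b : α with a ≤ b, ψ (OrderDual.toDual b) = 1 := fun a ha =>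
    sum_le_eq_one_of_signed_chain_count (hψ (OrderDual.toDual a) ha)
  set χ : α → ℝ := fun a => ψ (OrderDual.toDual a) with hχ
  have hχ0 : ∀ a, ¬ Q a → χ a = 0 := fun a ha => hψ0 _ ha
  have h1 : ∑ a, φ a = ∑ a, χ a := by
    calc ∑ a, φ a = ∑ a, φ a * ∑ b with a ≤ b, χ b := by
          refine Finset.sum_congr rfl fun a _ => ?_
          by_cases ha : Q a
          · rw [hψ1 a ha, mul_one]
          · rw [hφ0 a ha, zero_mul]
      _ = ∑ b, χ b * ∑ a with a ≤ b, φ a := by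
          simp_rw [Finset.sum_filter, Finset.mul_sum]
          rw [Finset.sum_comm]
          refine Finset.sum_congr rfl fun b _ => Finset.sum_congr rfl fun a _ => ?_
          split_ifs <;> ring
      _ = ∑ b, χ b := by
          refine Finset.sum_congr rfl fun b _ => ?_
          by_cases hb : Q b
          · rw [hφ1 b hb, mul_one]
          · rw [hχ0 b hb, zero_mul]
  calc ∑ a, φ a = ∑ a, χ a := h1
    _ = ∑ a, χ a * ∑ z with z ≤ a ⊓ m, φ z := by
        refine Finset.sum_congr rfl fun a _ => ?_
        by_cases ha : Q a
        · rw [hφ1 _ (hQ a ha), mul_one]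
        · rw [hχ0 a ha, zero_mul]
    _ = ∑ z with z ≤ m, φ z * ∑ a with z ≤ a, χ a := by
        simp_rw [Finset.sum_filter, Finset.mul_sum]
        rw [Finset.sum_comm]
        refine Finset.sum_congr rfl fun z _ => ?_
        by_cases hz : z ≤ m
        · simp only [le_inf_iff, hz, and_true, if_true]
          refine Finset.sum_congr rfl fun b _ => ?_
          split_ifs <;> ring
        · simp [hz]
    _ = ∑ z with z ≤ m, φ z := by
        refine Finset.sum_congr rfl fun z _ => ?_
        by_cases hz : Q z
        · rw [hψ1 z hz, mul_one]
        · rw [hφ0 z hz, zero_mul]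
    _ = 1 := hφ1 m hm

/-! ### Approximating combinations of conjunctions of negative literals -/

section Approximation

variable {ι : Type}

/-- The conjunction of the negative literals `¬ x i` for `i ∈ S`. -/
def negConj (S : Finset ι) (x : ι → Bool) : ℝ :=
  if ∀ i ∈ S, x i = false then 1 else 0

theorem negConj_union [DecidableEq ι] (S T : Finset ι) (x : ι → Bool) :
    negConj (S ∪ T) x = negConj S x * negConj T x := by
  simp only [negConj, Finset.mem_union, or_imp, forall_and, ite_and]
  split_ifs <;> simp

theorem exists_approx_negConj [Fintype ι] (L : ℕ) (hL : 0 < L) (S : Finset ι) (hι : 0 < Fintype.card ι) :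
    ∃ p : MvPolynomial ι ℝ, p.totalDegree ≤ ⌊5 * √((Fintype.card ι : ℝ) * L)⌋₊ ∧
      ∀ x : ι → Bool, |negConj S x -
        MvPolynomial.eval (fun i => if x i then (1 : ℝ) else 0) p| ≤ (1 / 2) ^ L := by
  obtain ⟨q, hq1, hq2, hq3⟩ := exists_polynomial_abs_le_half_pow (Fintype.card ι) L hι hL
  have hS : (∑ i ∈ S, MvPolynomial.X i : MvPolynomial ι ℝ).totalDegree ≤ 1 :=
    MvPolynomial.totalDegree_finsetSum_le fun i _ => by simp
  refine ⟨Polynomial.aeval (∑ i ∈ S, MvPolynomial.X i) q, ?_, fun x => ?_⟩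
  · rw [Polynomial.aeval_eq_sum_range]
    refine MvPolynomial.totalDegree_finsetSum_le fun k hk => ?_
    refine (MvPolynomial.totalDegree_smul_le _ _).trans
      ((MvPolynomial.totalDegree_pow _ _).trans ?_)
    have hk' : k ≤ q.natDegree := Nat.lt_succ_iff.1 (Finset.mem_range.1 hk)
    calc k * _ ≤ k * 1 := Nat.mul_le_mul_left k hS
      _ ≤ q.natDegree := by rwa [mul_one]
      _ ≤ _ := Nat.le_floor hq1
  · have h1 : MvPolynomial.eval (fun i => if x i then (1 : ℝ) else 0)
        (Polynomial.aeval (∑ i ∈ S, MvPolynomial.X i) q) =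
        q.eval ((#{i ∈ S | x i = true} : ℕ) : ℝ) := by
      rw [Polynomial.aeval_def, Polynomial.hom_eval₂, Polynomial.eval]
      congr 1
      · ext r
        simp
      · simp
    rw [h1, negConj]
    split_ifs with h
    · have : {i ∈ S | x i = true} = ∅ := by
        ext i
        simp +contextual [h]
      rw [this]
      simp [hq2]
    · push Not at h
      obtain ⟨i, hi, hxi⟩ := h
      rw [zero_sub, abs_neg]
      apply hq3
      · exact Finset.card_pos.2 ⟨i, by simpa [hi] using hxi⟩
      · exact Finset.card_le_univ _

/-- `f`, also after multiplication by any conjunction of negative literals, is approximated by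
polynomials of degree at most `d` to within `c * δ`. -/
def ConjApprox (d : ℕ) (δ c : ℝ) (f : (ι → Bool) → ℝ) : Prop :=
  ∀ S : Finset ι, ∃ p : MvPolynomial ι ℝ, p.totalDegree ≤ d ∧
    ∀ x : ι → Bool, |f x * negConj S x -
      MvPolynomial.eval (fun i => if x i then (1 : ℝ) else 0) p| ≤ c * δ

variable {d : ℕ} {δ c : ℝ}

theorem ConjApprox.mono {c' : ℝ} (hδ : 0 ≤ δ) {f : (ι → Bool) → ℝ} (hf : ConjApprox d δ c f)
    (h : c ≤ c') : ConjApprox d δ c' f := fun S => by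
  obtain ⟨p, hp1, hp2⟩ := hf S
  exact ⟨p, hp1, fun x => (hp2 x).trans (by gcongr)⟩

theorem ConjApprox.zero : ConjApprox d δ 0 (fun _ : ι → Bool => 0) :=
  fun _ => ⟨0, by simp, by simp⟩

theorem ConjApprox.mul_negConj [DecidableEq ι] {f : (ι → Bool) → ℝ} (hf : ConjApprox d δ c f)
    (T : Finset ι) : ConjApprox d δ c (fun x => negConj T x * f x) := fun S => by
  obtain ⟨p, hp1, hp2⟩ := hf (T ∪ S)
  refine ⟨p, hp1, fun x => ?_⟩
  have := hp2 x
  rwa [negConj_union, ← mul_assoc, mul_comm (f x)] at this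

theorem ConjApprox.sub {c' : ℝ} {f g : (ι → Bool) → ℝ} (hf : ConjApprox d δ c f)
    (hg : ConjApprox d δ c' g) : ConjApprox d δ (c + c') (fun x => f x - g x) := fun S => by
  obtain ⟨p, hp1, hp2⟩ := hf S
  obtain ⟨q, hq1, hq2⟩ := hg S
  refine ⟨p - q, (MvPolynomial.totalDegree_sub _ _).trans (max_le hp1 hq1), fun x => ?_⟩
  have h1 := abs_le.1 (hp2 x)
  have h2 := abs_le.1 (hq2 x)
  rw [map_sub, abs_le]
  constructor <;> linarith

theorem ConjApprox.sum {κ : Type*} (s : Finset κ) {c : κ → ℝ} {f : κ → (ι → Bool) → ℝ}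
    (hf : ∀ k ∈ s, ConjApprox d δ (c k) (f k)) :
    ConjApprox d δ (∑ k ∈ s, c k) (fun x => ∑ k ∈ s, f k x) := fun S => by
  choose! p hp1 hp2 using fun k hk => hf k hk S
  refine ⟨∑ k ∈ s, p k, MvPolynomial.totalDegree_finsetSum_le hp1, fun x => ?_⟩
  rw [map_sum, Finset.sum_mul, Finset.sum_mul, ← Finset.sum_sub_distrib]
  exact (Finset.abs_sum_le_sum_abs _ _).trans (Finset.sum_le_sum fun k hk => hp2 k hk x)

theorem ConjApprox.one [Fintype ι] (L : ℕ) (hL : 0 < L) (hι : 0 < Fintype.card ι) :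
    ConjApprox ⌊5 * √((Fintype.card ι : ℝ) * L)⌋₊ ((1 / 2) ^ L) 1
      (fun _ : ι → Bool => 1) := fun S => by
  simpa using exists_approx_negConj L hL S hι

end Approximation

theorem sum_ssubset_card_add_one_pow_le {α : Type*} [Fintype α] [DecidableEq α]
    (A : Finset α) :
    1 + ∑ B : Finset α with B < A, ((#B : ℝ) + 1) ^ #B ≤ ((#A : ℝ) + 1) ^ #A := by
  have h0 : (Finset.univ.filter (fun B : Finset α => B < A)) = A.powerset.erase A := by
    ext B
    simp [lt_iff_le_and_ne, and_comm]
  have h1 : ∑ B ∈ A.powerset, (#A : ℝ) ^ #B = ((#A : ℝ) + 1) ^ #A := by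
    simpa using Finset.sum_pow_mul_eq_add_pow (#A : ℝ) 1 A
  have h2 : ∑ B ∈ A.powerset.erase A, ((#B : ℝ) + 1) ^ #B ≤
      ∑ B ∈ A.powerset.erase A, (#A : ℝ) ^ #B := by
    refine Finset.sum_le_sum fun B hB => ?_
    rw [Finset.mem_erase, Finset.mem_powerset] at hB
    have : #B < #A := Finset.card_lt_card (lt_of_le_of_ne hB.2 hB.1)
    have : (#B : ℝ) + 1 ≤ #A := by exact_mod_cast this
    gcongr
  have h3 := Finset.sum_erase_add A.powerset (fun B => (#A : ℝ) ^ #B) (Finset.mem_powerset_self A)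
  have h4 : (1 : ℝ) ≤ (#A : ℝ) ^ #A := by
    rcases Nat.eq_zero_or_pos #A with h | h
    · simp [h]
    · exact one_le_pow₀ (by exact_mod_cast h)
  rw [h0]
  linarith

/-! ### Hall violators -/

section Hall

variable {n : ℕ}

/-- `A = S ⊔ U` is a Hall violator of `x` if all neighbours of the left vertices in `S` lie in `U`
and `S` has more elements than `U`. -/
def IsHallViolator (x : Fin n × Fin n → Bool) (A : Finset (Fin n ⊕ Fin n)) : Prop :=
  #A.toRight < #A.toLeft ∧ ∀ e ∈ A.toLeft ×ˢ A.toRightᶜ, x e = false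

theorem exists_isHallViolator_iff (x : Fin n × Fin n → Bool) :
    (∃ A, IsHallViolator x A) ↔ ¬ ∃ σ : Equiv.Perm (Fin n), ∀ i, x (i, σ i) = true := by
  classical
  have hall := Fintype.all_card_le_filter_rel_iff_exists_injective
    (fun i j : Fin n => x (i, j) = true)
  have h1 : (∃ f : Fin n → Fin n, Function.Injective f ∧ ∀ i, x (i, f i) = true) ↔
      ∃ σ : Equiv.Perm (Fin n), ∀ i, x (i, σ i) = true := by
    constructor
    · rintro ⟨f, hf, h⟩
      exact ⟨Equiv.ofBijective f (Finite.injective_iff_bijective.1 hf), h⟩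
    · rintro ⟨σ, h⟩
      exact ⟨σ, σ.injective, h⟩
  rw [← h1, ← hall]
  push Not
  constructor
  · rintro ⟨A, hA1, hA2⟩
    refine ⟨A.toLeft, lt_of_le_of_lt (Finset.card_le_card fun j hj => ?_) hA1⟩
    obtain ⟨i, hi, hij⟩ : ∃ i ∈ A.toLeft, x (i, j) = true := by simpa using hj
    by_contra hj'
    have := hA2 (i, j) (by simpa using ⟨by simpa using hi, by simpa using hj'⟩)
    simp [hij] at this
  · rintro ⟨S, hS⟩
    refine ⟨S.disjSum _, lt_of_eq_of_lt (congrArg Finset.card Finset.toRight_disjSum)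
      (lt_of_lt_of_eq hS (congrArg Finset.card Finset.toLeft_disjSum.symm)), ?_⟩
    · rintro ⟨i, j⟩ h
      simp only [Finset.toLeft_disjSum, Finset.toRight_disjSum, Finset.mem_product,
        Finset.mem_compl, Finset.mem_filter, Finset.mem_univ, true_and, not_exists, not_and] at h
      simpa using h.2 i h.1

theorem IsHallViolator.exists_inter {x : Fin n × Fin n → Bool}
    (h : ∃ A, IsHallViolator x A) :
    ∃ M, IsHallViolator x M ∧ ∀ A, IsHallViolator x A → IsHallViolator x (A ⊓ M) := by
  classical
  obtain ⟨M, hM, hmax⟩ := (Finset.univ.filter (IsHallViolator x)).exists_max_image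
    (fun A => (#A.toLeft : ℤ) - #A.toRight) (by obtain ⟨A, hA⟩ := h; exact ⟨A, by simpa using hA⟩)
  rw [Finset.mem_filter] at hM
  refine ⟨M, hM.2, fun A hA => ?_⟩
  obtain ⟨hM1, hM2⟩ := hM.2
  obtain ⟨hA1, hA2⟩ := hA
  simp only [Finset.mem_product, Finset.mem_compl, Finset.mem_toLeft, Finset.mem_toRight]
    at hM2 hA2
  have hl := Finset.card_union_add_card_inter A.toLeft M.toLeft
  have hr := Finset.card_union_add_card_inter A.toRight M.toRight
  rw [← Finset.toLeft_union, ← Finset.toLeft_inter] at hl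
  rw [← Finset.toRight_union, ← Finset.toRight_inter] at hr
  have hunion : (#(A ∪ M).toLeft : ℤ) - #(A ∪ M).toRight ≤ #M.toLeft - #M.toRight := by
    by_cases hlt : #(A ∪ M).toRight < #(A ∪ M).toLeft
    · refine hmax _ (Finset.mem_filter.2 ⟨Finset.mem_univ _, hlt, fun e he => ?_⟩)
      simp only [Finset.mem_product, Finset.mem_compl, Finset.mem_toLeft, Finset.mem_toRight,
        Finset.mem_union, not_or] at he
      rcases he.1 with h1 | h1
      · exact hA2 e ⟨h1, he.2.1⟩
      · exact hM2 e ⟨h1, he.2.2⟩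
    · omega
  refine ⟨?_, fun e he => ?_⟩
  · rw [Finset.inf_eq_inter]
    omega
  · simp only [Finset.mem_product, Finset.mem_compl, Finset.mem_toLeft, Finset.mem_toRight,
      Finset.inf_eq_inter, Finset.mem_inter, not_and_or] at he
    rcases he.2 with h1 | h1
    · exact hA2 e ⟨he.1.1, h1⟩
    · exact hM2 e ⟨he.1.2, h1⟩

/-- `1 - BPM_n` is a combination of conjunctions of negative literals with coefficients of total
size at most `(2n + 2)^(2n)`. -/
theorem conjApprox_one_sub_BPM {d : ℕ} {δ : ℝ} (hδ : 0 ≤ δ)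
    (hone : ConjApprox d δ 1 (fun _ : Fin n × Fin n → Bool => 1)) :
    ConjApprox d δ ((2 * n + 2) ^ (2 * n))
      (fun x => 1 - if BPM n x then (1 : ℝ) else 0) := by
  classical
  choose φ hφ0 hφ using fun x : Fin n × Fin n → Bool =>
    exists_signed_chain_count (IsHallViolator x)
  have hφA : ∀ A, ConjApprox d δ (((#A : ℝ) + 1) ^ #A) (fun x => φ x A) := by
    intro A
    induction A using WellFoundedLT.induction with
    | ind A ih =>
      by_cases hA : #A.toRight < #A.toLeft
      · have h1 := (hone.sub (ConjApprox.sum (Finset.univ.filter (· < A))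
          fun B hB => ih B (Finset.mem_filter.1 hB).2)).mul_negConj (A.toLeft ×ˢ A.toRightᶜ)
        have h2 := h1.mono hδ (sum_ssubset_card_add_one_pow_le A)
        convert h2 using 2 with x
        by_cases hx : IsHallViolator x A
        · rw [hφ x A hx, negConj, if_pos hx.2, one_mul]
          congr!
        · rw [hφ0 x A hx, negConj, if_neg fun h => hx ⟨hA, h⟩, zero_mul]
      · have : (fun x => φ x A) = fun _ => 0 := by
          ext x
          exact hφ0 x A fun h => hA h.1
        rw [this]
        exact ConjApprox.zero.mono hδ (by positivity)
  have hsum : ∀ x, ∑ A, φ x A = 1 - if BPM n x then (1 : ℝ) else 0 := by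
    intro x
    by_cases h : ∃ A, IsHallViolator x A
    · obtain ⟨M, hM, hM'⟩ := IsHallViolator.exists_inter h
      rw [sum_signed_chain_count_eq_one (IsHallViolator x) M hM hM' (φ x) (hφ0 x) (hφ x)]
      simp [BPM, (exists_isHallViolator_iff x).1 h]
    · have h' : BPM n x = true := by
        rw [exists_isHallViolator_iff, not_not] at h
        simpa [BPM] using h
      push Not at h
      rw [Finset.sum_eq_zero fun A _ => hφ0 x A (h A)]
      simp [h']
  have h3 := (ConjApprox.sum Finset.univ fun A _ => hφA A).mono (c' := (2 * n + 2) ^ (2 * n)) hδ ?_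
  · simpa only [hsum] using h3
  · have hcard : Fintype.card (Fin n ⊕ Fin n) = 2 * n := by simp [two_mul]
    calc ∑ A : Finset (Fin n ⊕ Fin n), ((#A : ℝ) + 1) ^ #A
        ≤ ∑ A : Finset (Fin n ⊕ Fin n), (2 * n + 1 : ℝ) ^ #A := by
          refine Finset.sum_le_sum fun A _ => ?_
          have : #A ≤ 2 * n := hcard ▸ Finset.card_le_univ A
          have : (#A : ℝ) ≤ 2 * n := by exact_mod_cast this
          gcongr
      _ = (2 * n + 2) ^ (2 * n) := by
          have := Fintype.sum_pow_mul_eq_add_pow (Fin n ⊕ Fin n) (2 * n + 1 : ℝ) 1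
          rw [hcard] at this
          simp only [one_pow, mul_one] at this
          rw [this]
          ring

end Hall

theorem apxDeg_le {ι : Type} [Fintype ι] {f : (ι → Bool) → Bool} {ε : ℝ} (p : MvPolynomial ι ℝ)
    (h : ∀ x : ι → Bool, |(if f x then (1 : ℝ) else 0) -
      MvPolynomial.eval (fun i => if x i then (1 : ℝ) else 0) p| ≤ ε) :
    apxDeg ι f ε ≤ p.totalDegree :=
  Nat.sInf_le ⟨p, rfl, h⟩

theorem apxDeg_BPM_le_of_pow_le {n : ℕ} (hn : 0 < n) {L : ℕ} (hL : 0 < L) {ε : ℝ}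
    (h : (2 * (n : ℝ) + 2) ^ (2 * n) * (1 / 2) ^ L ≤ ε) :
    (apxDeg (Fin n × Fin n) (BPM n) ε : ℝ) ≤ 5 * √((n : ℝ) ^ 2 * L) := by
  have hcard : Fintype.card (Fin n × Fin n) = n ^ 2 := by simp [sq]
  have hone := ConjApprox.one (ι := Fin n × Fin n) L hL (by rw [hcard]; positivity)
  obtain ⟨p, hp1, hp2⟩ := conjApprox_one_sub_BPM (by positivity) hone ∅
  have h1 : apxDeg (Fin n × Fin n) (BPM n) ε ≤ (1 - p).totalDegree := by
    refine apxDeg_le _ fun x => ?_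
    have := (hp2 x).trans h
    simp only [negConj, Finset.notMem_empty, false_imp_iff, implies_true, if_true, mul_one] at this
    rwa [map_sub, map_one, abs_sub_comm, sub_right_comm]
  have h2 : (1 - p).totalDegree ≤ ⌊5 * √((n : ℝ) ^ 2 * L)⌋₊ := by
    refine (MvPolynomial.totalDegree_sub _ _).trans (max_le (by simp) ?_)
    simpa [hcard] using hp1
  exact (Nat.cast_le.2 (h1.trans h2)).trans (Nat.floor_le (by positivity))

/-- There is a constant `C > 0` such that for all `n > 1` and all
`2^{−n log₂ n} ≤ ε ≤ 1/3`, we have `deg̃_ε(BPM_n) ≤ C · n^{3/2} · √(log n)`. -/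
theorem apxDeg_BPM_upper :
    ∃ C : ℝ, 0 < C ∧ ∀ n : ℕ, 1 < n → ∀ ε : ℝ,
      (2 : ℝ) ^ (-((n : ℝ) * Real.logb 2 n)) ≤ ε → ε ≤ 1 / 3 →
      (apxDeg (Fin n × Fin n) (BPM n) ε : ℝ) ≤
        C * (n : ℝ) ^ ((3 : ℝ) / 2) * Real.sqrt (Real.log n) := by
  refine ⟨20, by norm_num, fun n hn ε hε _ => ?_⟩
  have hn2 : (2 : ℝ) ≤ n := by exact_mod_cast hn
  have hn0 : (0 : ℝ) < n := by linarith
  have hlog1 : 1 ≤ Real.logb 2 n := by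
    rw [Real.le_logb_iff_rpow_le one_lt_two hn0]
    simpa using hn2
  set y : ℝ := (n : ℝ) * Real.logb 2 n with hy
  have hy1 : 1 ≤ y := by nlinarith
  set L : ℕ := ⌈7 * y⌉₊
  have hL1 : 7 * y ≤ L := Nat.le_ceil _
  have hL2 : (L : ℝ) ≤ 8 * y := by
    have := Nat.ceil_lt_add_one (a := 7 * y) (by linarith)
    linarith
  have hL0 : 0 < L := by
    have : (0 : ℝ) < L := by linarith
    exact_mod_cast this
  have hpow : (n : ℝ) ^ n = 2 ^ y := by
    rw [hy, mul_comm, Real.rpow_mul two_pos.le, Real.rpow_logb two_pos (by norm_num) hn0,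
      Real.rpow_natCast]
  have hbound : (2 * (n : ℝ) + 2) ^ (2 * n) * (1 / 2) ^ L ≤ ε := by
    have h1 : (2 * (n : ℝ) + 2) ^ (2 * n) ≤ 2 ^ (6 * y) := by
      calc (2 * (n : ℝ) + 2) ^ (2 * n) ≤ ((n : ℝ) ^ 3) ^ (2 * n) := by
            gcongr
            nlinarith [mul_nonneg (sub_nonneg.2 hn2) (sq_nonneg (n : ℝ))]
        _ = ((n : ℝ) ^ n) ^ 6 := by rw [← pow_mul, ← pow_mul]; congr 1; ring
        _ = 2 ^ (6 * y) := by
            rw [hpow, ← Real.rpow_natCast, ← Real.rpow_mul two_pos.le]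
            congr 1
            push_cast
            ring
    have h2 : ((1 : ℝ) / 2) ^ L ≤ 2 ^ (-(7 * y)) := by
      rw [one_div, inv_pow, ← Real.rpow_natCast, ← Real.rpow_neg two_pos.le]
      exact Real.rpow_le_rpow_of_exponent_le one_le_two (by linarith)
    calc (2 * (n : ℝ) + 2) ^ (2 * n) * (1 / 2) ^ L ≤ 2 ^ (6 * y) * 2 ^ (-(7 * y)) := by gcongr
      _ = 2 ^ (-y) := by rw [← Real.rpow_add two_pos]; congr 1; ring
      _ ≤ ε := hε
  refine (apxDeg_BPM_le_of_pow_le (by omega) hL0 hbound).trans ?_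
  have hlog0 : 0 ≤ Real.log n := Real.log_nonneg (by linarith)
  have hlogb : Real.logb 2 n ≤ 2 * Real.log n := by
    rw [Real.logb, div_le_iff₀ (Real.log_pos one_lt_two)]
    nlinarith [Real.log_two_gt_d9]
  have h3 : (n : ℝ) ^ ((3 : ℝ) / 2) = n * √n := by
    rw [Real.sqrt_eq_rpow, ← Real.rpow_one_add' hn0.le (by norm_num)]
    norm_num
  have h4 : √((n : ℝ) ^ 2 * L) ≤ 4 * (n * √n * √(Real.log n)) := by
    rw [Real.sqrt_le_left (by positivity)]
    have e : (4 * (n * √n * √(Real.log n))) ^ 2 =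
        (n : ℝ) ^ 2 * (16 * n * Real.log n) := by
      rw [mul_pow, mul_pow, mul_pow, Real.sq_sqrt hn0.le, Real.sq_sqrt hlog0]
      ring
    rw [e]
    gcongr
    have : y ≤ n * (2 * Real.log n) := by rw [hy]; gcongr
    linarith
  rw [h3]
  linarith
end

section
/- Let n ∈ ℕ, n ≥ 2. The sensitivity of the bipartite perfect matching function satisfies: if n is even then sens(BPM_n) ≥ (n/2)·(n/2 + 1), and if n is odd then sens(BPM_n) ≥ ((n−1)/2 + 1)². -/
/-- The sensitivity of a Boolean function `f : {0,1}^ι → {0,1}`: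
`sens(f) = max_x |{i : f(x) ≠ f(x^i)}|`. -/
def sens (ι : Type) [Fintype ι] [DecidableEq ι] (f : (ι → Bool) → Bool) : ℕ :=
  Finset.univ.sup (fun x : ι → Bool =>
    (Finset.univ.filter (fun i : ι => f (Function.update x i (!(x i))) ≠ f x)).card)

/-- The bipartite graph containing every edge outside the block `{i ≤ p} × {j ≥ p}`. -/
def blockGraph {n : ℕ} (p : Fin n) (e : Fin n × Fin n) : Bool :=
  decide (p < e.1 ∨ e.2 < p)

theorem BPM_blockGraph {n : ℕ} (p : Fin n) : BPM n (blockGraph p) = false := by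
  simp only [BPM, blockGraph, decide_eq_false_iff_not, decide_eq_true_eq]
  rintro ⟨σ, hσ⟩
  have h : (Finset.Iic p).card ≤ (Finset.Iio p).card := by
    refine Finset.card_le_card_of_injOn σ (fun i hi => ?_) σ.injective.injOn
    have hi' : i ≤ p := by simpa using hi
    simpa using (hσ i).resolve_left hi'.not_gt
  simp only [Fin.card_Iic, Fin.card_Iio] at h
  omega

theorem BPM_update_blockGraph {n : ℕ} {p i j : Fin n} (hi : i ≤ p) (hj : p ≤ j) :
    BPM n (Function.update (blockGraph p) (i, j) true) = true := by
  simp only [BPM, decide_eq_true_eq]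
  refine ⟨(Equiv.swap i p).trans (Equiv.swap p j), fun k => ?_⟩
  by_cases hk : k = i
  · subst hk
    simp
  · rw [Function.update_of_ne (by simp [hk])]
    simp only [blockGraph, Equiv.trans_apply, Equiv.swap_apply_def]
    grind

theorem card_block_le_sens_BPM {n : ℕ} (p : Fin n) :
    (p + 1) * (n - p) ≤ sens (Fin n × Fin n) (BPM n) := by
  calc (p + 1) * (n - p) = (Finset.Iic p ×ˢ Finset.Ici p).card := by
        rw [Finset.card_product, Fin.card_Iic, Fin.card_Ici]
    _ ≤ (Finset.univ.filter (fun e : Fin n × Fin n =>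
          BPM n (Function.update (blockGraph p) e (!(blockGraph p e))) ≠
            BPM n (blockGraph p))).card := by
        refine Finset.card_le_card fun ⟨i, j⟩ he => ?_
        obtain ⟨hi, hj⟩ : i ≤ p ∧ p ≤ j := by simpa using he
        have hb : blockGraph p (i, j) = false := by simp [blockGraph, hi, hj]
        simp [hb, BPM_blockGraph, BPM_update_blockGraph hi hj]
    _ ≤ sens (Fin n × Fin n) (BPM n) :=
        Finset.le_sup (f := fun x : Fin n × Fin n → Bool => (Finset.univ.filter
          (fun e => BPM n (Function.update x e (!(x e))) ≠ BPM n x)).card)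
          (Finset.mem_univ (blockGraph p))


/-- For `n ≥ 2`: if `n` is even then `sens(BPM_n) ≥ (n/2)·(n/2 + 1)`, and if `n` is
odd then `sens(BPM_n) ≥ ((n−1)/2 + 1)²`. -/
theorem sens_BPM_lower (n : ℕ) (hn : 2 ≤ n) :
    (Even n → n / 2 * (n / 2 + 1) ≤ sens (Fin n × Fin n) (BPM n)) ∧
    (Odd n → ((n - 1) / 2 + 1) ^ 2 ≤ sens (Fin n × Fin n) (BPM n)) := by
  have h := card_block_le_sens_BPM (⟨n / 2, by omega⟩ : Fin n)
  constructor
  · rintro ⟨k, rfl⟩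
    rw [show (k + k) / 2 = k by omega]
    simp only [show (k + k) / 2 = k by omega, Nat.add_sub_cancel] at h
    rwa [mul_comm]
  · rintro ⟨k, rfl⟩
    rw [show (2 * k + 1 - 1) / 2 = k by omega]
    simp only [show (2 * k + 1) / 2 = k by omega, show 2 * k + 1 - k = k + 1 by omega] at h
    rwa [sq]
end

section
/- For every n ∈ ℕ, n ≥ 1, the 1/3-approximate degree of the bipartite perfect matching function satisfies deg̃_{1/3}(BPM_n) ≥ (1/√6) · (⌊(n−1)/2⌋ + 1); in particular deg̃_{1/3}(BPM_n) = Ω(n). -/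
section Markov

open Polynomial Polynomial.Chebyshev

/-- Markov's inequality at the right endpoint of the interval `[-1, 1]`. -/
lemma eval_one_derivative_le {d : ℕ} {q : ℝ[X]} {H : ℝ} (hq : q.natDegree ≤ d) (hH : 0 < H)
    (h : ∀ x ∈ Set.Icc (-1 : ℝ) 1, |q.eval x| ≤ H) :
    (derivative q).eval 1 ≤ (d : ℝ) ^ 2 * H := by
  have key := eval_iterate_derivative_le_of_forall_abs_le_one (n := d) (P := C H⁻¹ * q) (k := 1)
    (x := 1) le_rfl
    (degree_le_of_natDegree_le ((natDegree_C_mul_le _ _).trans hq)) (by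
      intro x hx
      rw [eval_mul, eval_C, abs_mul, abs_of_pos (inv_pos.2 hH), inv_mul_le_iff₀ hH, mul_one]
      exact h x hx)
  simp only [Function.iterate_one, derivative_C_mul, eval_mul, eval_C, derivative_T_eval_one] at key
  rw [inv_mul_le_iff₀ hH] at key
  push_cast at key
  linarith

/-- Markov's inequality at an endpoint `b` of the interval with endpoints `a` and `b`, for a
polynomial whose values lie within `H` of `m`. -/
lemma eval_endpoint_derivative_le {d : ℕ} {q : ℝ[X]} {H a b m : ℝ} (hq : q.natDegree ≤ d)
    (hH : 0 < H) (h : ∀ x ∈ Set.uIcc a b, |q.eval x - m| ≤ H) :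
    |(derivative q).eval b| * |b - a| ≤ 2 * (d : ℝ) ^ 2 * H := by
  have aux : ∀ s : ℝ, |s| = 1 →
      s * (derivative q).eval b * ((b - a) / 2) ≤ (d : ℝ) ^ 2 * H := by
    intro s hs
    have hl : (C ((b - a) / 2) * X + C ((a + b) / 2) : ℝ[X]).natDegree ≤ 1 := natDegree_linear_le
    have key := eval_one_derivative_le (d := d) (H := H)
      (q := C s * ((q - C m).comp (C ((b - a) / 2) * X + C ((a + b) / 2)))) ?_ hH ?_
    · simp only [derivative_C_mul, derivative_comp, derivative_sub, derivative_add, derivative_C,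
        derivative_X, eval_mul, eval_C, eval_comp, eval_add, eval_X, sub_zero, add_zero,
        mul_one] at key
      rw [show (b - a) / 2 + (a + b) / 2 = b by ring] at key
      linarith
    · refine (natDegree_C_mul_le _ _).trans (natDegree_comp_le.trans ?_)
      rw [natDegree_sub_C]
      nlinarith
    · intro x hx
      rw [eval_mul, eval_C, abs_mul, hs, one_mul, eval_comp, eval_sub, eval_C]
      apply h
      simp only [eval_add, eval_mul, eval_C, eval_X]
      obtain ⟨h1, h2⟩ := hx
      rcases le_total a b with hab | hab
      · rw [Set.uIcc_of_le hab]
        constructor <;> nlinarith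
      · rw [Set.uIcc_of_ge hab]
        constructor <;> nlinarith
  have h1 := aux 1 (by simp)
  have h2 := aux (-1) (by simp)
  rw [← abs_mul]
  apply abs_le.2
  constructor <;> linarith

/-- A polynomial of degree at most `d` which is close to `0` at `0` and close to `1` at
`1, …, N` satisfies `N ≤ 6 d²`. -/
lemma le_six_mul_sq_of_approx_or {d N : ℕ} {q : ℝ[X]} (hN : 1 ≤ N) (hq : q.natDegree ≤ d)
    (h0 : |q.eval 0| ≤ 1 / 3)
    (h1 : ∀ k : ℕ, 1 ≤ k → k ≤ N → |q.eval (k : ℝ) - 1| ≤ 1 / 3) : N ≤ 6 * d ^ 2 := by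
  have hN' : (1 : ℝ) ≤ N := by exact_mod_cast hN
  obtain ⟨z, hz, hmax⟩ := isCompact_Icc.exists_isMaxOn (s := Set.Icc (0 : ℝ) N)
    ⟨0, by simp⟩ (f := fun x => |(derivative q).eval x|)
    ((derivative q).continuous.abs.continuousOn)
  set c := |(derivative q).eval z|
  have hmax' : ∀ x ∈ Set.Icc (0 : ℝ) N, |(derivative q).eval x| ≤ c := fun x hx => hmax hx
  have lip : ∀ x ∈ Set.Icc (0 : ℝ) N, ∀ y ∈ Set.Icc (0 : ℝ) N,
      |q.eval y - q.eval x| ≤ c * |y - x| := by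
    intro x hx y hy
    exact Convex.norm_image_sub_le_of_norm_deriv_le (f := fun t => q.eval t)
      (fun t _ => q.differentiableAt) (fun t ht => by
        rw [Polynomial.deriv]; exact hmax' t ht) (convex_Icc (0 : ℝ) N) hx hy
  have near : ∀ x ∈ Set.Icc (0 : ℝ) N, ∃ k : ℕ, k ≤ N ∧ |x - k| ≤ 1 / 2 := by
    intro x hx
    have hx0 : 0 ≤ x + 1 / 2 := by linarith [hx.1]
    refine ⟨⌊x + 1 / 2⌋₊, ?_, ?_⟩
    · have : ⌊x + 1 / 2⌋₊ < N + 1 := by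
        rw [Nat.floor_lt hx0]; push_cast; linarith [hx.2]
      omega
    · have := Nat.floor_le hx0
      have := Nat.lt_floor_add_one (x + 1 / 2)
      rw [abs_le]; constructor <;> linarith
  have hq1 := abs_le.1 (h1 1 le_rfl hN)
  have hq0 := abs_le.1 h0
  push_cast at hq1
  have hc0 : 0 ≤ c := abs_nonneg _
  obtain ⟨y, hy, hyd⟩ := exists_deriv_eq_slope (fun t => q.eval t) (zero_lt_one (α := ℝ))
    q.continuous.continuousOn q.differentiable.differentiableOn
  have hy3 : 1 / 3 ≤ (derivative q).eval y := by
    rw [Polynomial.deriv] at hyd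
    rw [hyd]; linarith [hq1.1, hq0.2]
  have cast_le : ∀ k : ℕ, k ≤ N → (k : ℝ) ∈ Set.Icc (0 : ℝ) N := fun k hk =>
    ⟨by positivity, by exact_mod_cast hk⟩
  rcases le_total c (5 / 6) with hc5 | hc5
  · have key := eval_endpoint_derivative_le (d := d) (q := q) (H := 1 / 3 + 3 / 4 * c)
      (a := N) (b := y) (m := 1 - c / 4) hq (by positivity) (by
        intro x hx
        rw [Set.uIcc_of_ge (by linarith [hy.2])] at hx
        have hx' : x ∈ Set.Icc (0 : ℝ) N := ⟨by linarith [hx.1, hy.1], hx.2⟩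
        obtain ⟨k, hkN, hk⟩ := near x hx'
        have h3 := abs_le.1 ((lip k (cast_le k hkN) x hx').trans
          (mul_le_mul_of_nonneg_left hk hc0))
        rcases Nat.eq_zero_or_pos k with rfl | hk1
        · rw [Nat.cast_zero] at h3 hk
          have h2 : c * |x - 1| ≤ c * 1 := by
            gcongr
            rw [abs_le]; constructor <;> linarith [hx'.1, (abs_le.1 hk).2]
          have h4 := abs_le.1 ((lip 1 (by simpa using hN) x hx').trans h2)
          rw [abs_le]; constructor <;> linarith [h3.2, h4.1, hq0.2, hq1.1]
        · have h2 := abs_le.1 (h1 k hk1 hkN)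
          rw [abs_le]; constructor <;> linarith [h2.1, h2.2, h3.1, h3.2])
    rw [abs_of_nonneg (by linarith : 0 ≤ (derivative q).eval y),
      abs_of_nonpos (by linarith [hy.2] : y - (N : ℝ) ≤ 0)] at key
    have h4 : 1 / 3 * (N - 1 : ℝ) < 2 * (d : ℝ) ^ 2 * (1 / 3 + 3 / 4 * c) := by
      refine lt_of_lt_of_le ?_ key
      nlinarith [hy.2]
    have h5 : 2 * (d : ℝ) ^ 2 * (1 / 3 + 3 / 4 * c) ≤ 2 * (d : ℝ) ^ 2 * (23 / 24) := by
      gcongr; linarith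
    have h6 : (4 * N : ℝ) < 4 + 23 * (d : ℝ) ^ 2 := by linarith
    have h7 : 4 * N < 4 + 23 * d ^ 2 := by exact_mod_cast h6
    rcases lt_or_ge d 2 with hd | hd
    · interval_cases d <;> omega
    · have : 2 ^ 2 ≤ d ^ 2 := Nat.pow_le_pow_left hd 2
      omega
  · have bound : ∀ x ∈ Set.Icc (0 : ℝ) N, |q.eval x - 1 / 2| ≤ 5 / 6 + c / 2 := by
      intro x hx
      obtain ⟨k, hkN, hk⟩ := near x hx
      have h2 : |q.eval (k : ℝ) - 1 / 2| ≤ 5 / 6 := by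
        rw [abs_le]
        rcases Nat.eq_zero_or_pos k with rfl | hk0
        · push_cast; constructor <;> linarith [hq0.1, hq0.2]
        · have := abs_le.1 (h1 k hk0 hkN)
          constructor <;> linarith [this.1, this.2]
      have h2 := abs_le.1 h2
      have h3 := abs_le.1 ((lip k (cast_le k hkN) x hx).trans
        (mul_le_mul_of_nonneg_left hk hc0))
      rw [abs_le]; constructor <;> linarith [h2.1, h2.2, h3.1, h3.2]
    have key : ∀ a ∈ Set.Icc (0 : ℝ) N, c * |z - a| ≤ 2 * (d : ℝ) ^ 2 * (5 / 6 + c / 2) :=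
      fun a ha => eval_endpoint_derivative_le hq (by positivity) fun x hx =>
        bound x (Set.uIcc_subset_Icc ha hz hx)
    have hh : c * (N / 2) ≤ 2 * (d : ℝ) ^ 2 * (5 / 6 + c / 2) := by
      rcases le_total z (N / 2 : ℝ) with hzN | hzN
      · refine le_trans ?_ (key N ⟨by positivity, le_rfl⟩)
        gcongr
        rw [le_abs]; right; linarith
      · refine le_trans ?_ (key 0 ⟨le_rfl, by positivity⟩)
        gcongr
        rw [le_abs]; left; linarith
    have h5 : 2 * (d : ℝ) ^ 2 * (5 / 6 + c / 2) ≤ 2 * (d : ℝ) ^ 2 * (3 / 2 * c) := by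
      gcongr; linarith
    have h6 : (N : ℝ) ≤ 6 * (d : ℝ) ^ 2 := by
      have : c * (N / 2) ≤ c * (3 * (d : ℝ) ^ 2) := by linarith
      linarith [le_of_mul_le_mul_left this (by linarith)]
    exact_mod_cast h6

end Markov

section Symmetrization

open Finset

/-- The number of `k`-element subsets of `B` that contain `S`. -/
lemma choose_mul_descFactorial_div {ι : Type*} [DecidableEq ι] {S B : Finset ι} (hS : S ⊆ B)
    (k : ℕ) :
    ((#B).choose k : ℝ) * ((k.descFactorial #S : ℝ) / (#B).descFactorial #S) =
      #((B.powersetCard k).filter (S ⊆ ·)) := by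
  have hSB := card_le_card hS
  have hpos : ((#B).descFactorial #S : ℝ) ≠ 0 := by
    have : (#B).descFactorial #S ≠ 0 := by rw [Ne, Nat.descFactorial_eq_zero_iff_lt]; omega
    exact_mod_cast this
  rcases le_or_gt #S k with hs | hs
  · rw [card_filter_powersetCard_subset S B k hS hs, mul_div_assoc', div_eq_iff hpos]
    have := Nat.choose_mul (n := #B) hs
    rw [Nat.descFactorial_eq_factorial_mul_choose, Nat.descFactorial_eq_factorial_mul_choose]
    norm_cast
    linear_combination (#S).factorial * this
  · rw [Nat.descFactorial_eq_zero_iff_lt.2 hs, filter_false_of_mem]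
    · simp
    · intro K hK hSK
      have := card_le_card hSK
      rw [(mem_powersetCard.1 hK).2] at this
      omega

/-- Minsky–Papert symmetrization over the variables in `B`, the other variables being set
to `1`. -/
lemma exists_symmetrization {ι : Type*} [DecidableEq ι] (B : Finset ι) (p : MvPolynomial ι ℝ) :
    ∃ q : Polynomial ℝ, q.natDegree ≤ p.totalDegree ∧ ∀ k : ℕ,
      ((#B).choose k : ℝ) * q.eval (k : ℝ) = ∑ K ∈ B.powersetCard k,
        MvPolynomial.eval (fun i => if i ∈ B → i ∈ K then (1 : ℝ) else 0) p := by
  refine ⟨∑ m ∈ p.support, Polynomial.C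
    (p.coeff m / ((#B).descFactorial #(m.support ∩ B) : ℝ)) *
      descPochhammer ℝ #(m.support ∩ B), ?_, ?_⟩
  · refine Polynomial.natDegree_sum_le_of_forall_le _ _ fun m hm => ?_
    refine (Polynomial.natDegree_C_mul_le _ _).trans ?_
    rw [descPochhammer_natDegree]
    calc #(m.support ∩ B) ≤ #m.support := card_le_card inter_subset_left
      _ = ∑ i ∈ m.support, 1 := by simp
      _ ≤ ∑ i ∈ m.support, m i := sum_le_sum fun i hi =>
          Nat.one_le_iff_ne_zero.2 (Finsupp.mem_support_iff.1 hi)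
      _ ≤ p.totalDegree := MvPolynomial.le_totalDegree hm
  · intro k
    simp_rw [MvPolynomial.eval_eq]
    rw [sum_comm, Polynomial.eval_finsetSum, mul_sum]
    refine sum_congr rfl fun m _ => ?_
    rw [← mul_sum, Polynomial.eval_mul, Polynomial.eval_C, descPochhammer_eval_eq_descFactorial]
    have hmon : ∀ K ∈ B.powersetCard k,
        ∏ i ∈ m.support, (if i ∈ B → i ∈ K then (1 : ℝ) else 0) ^ m i =
          if m.support ∩ B ⊆ K then 1 else 0 := by
      intro K _
      split_ifs with h
      · refine prod_eq_one fun i hi => ?_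
        rw [if_pos fun hB => h (mem_inter.2 ⟨hi, hB⟩), one_pow]
      · obtain ⟨i, hi, hiK⟩ := not_subset.1 h
        obtain ⟨hi, hB⟩ := mem_inter.1 hi
        refine prod_eq_zero hi ?_
        rw [if_neg fun h => hiK (h hB), zero_pow (Finsupp.mem_support_iff.1 hi)]
    rw [sum_congr rfl hmon, sum_boole, ← choose_mul_descFactorial_div inter_subset_right k]
    ring

end Symmetrization

/-- If `f` restricts to the OR function on the variables in `B` when the others are set to `true`,
every polynomial `1/3`-approximating `f` has degree at least `√(|B| / 6)`. -/
lemma card_le_six_mul_totalDegree_sq {ι : Type*} [DecidableEq ι] {f : (ι → Bool) → Bool}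
    {B : Finset ι} (hB : B.Nonempty)
    (hf : ∀ K ⊆ B, (f (fun i => decide (i ∈ B → i ∈ K)) = true ↔ K.Nonempty))
    {p : MvPolynomial ι ℝ}
    (hp : ∀ x : ι → Bool, |(if f x then (1 : ℝ) else 0) -
      MvPolynomial.eval (fun i => if x i then (1 : ℝ) else 0) p| ≤ 1 / 3) :
    B.card ≤ 6 * p.totalDegree ^ 2 := by
  obtain ⟨q, hq, hqk⟩ := exists_symmetrization B p
  refine le_six_mul_sq_of_approx_or hB.card_pos hq ?_ ?_
  · have h := hqk 0
    have := hp (fun i => decide (i ∈ B → i ∈ (∅ : Finset ι)))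
    rw [if_neg (by rw [hf ∅ (by simp)]; simp), zero_sub, abs_neg] at this
    simp only [decide_eq_true_eq] at this
    simp only [Nat.choose_zero_right, Nat.cast_one, one_mul, Nat.cast_zero,
      Finset.powersetCard_zero, Finset.sum_singleton] at h
    rwa [h]
  · intro k hk1 hk
    have h := hqk k
    have hpos : (0 : ℝ) < (B.card.choose k : ℝ) := by exact_mod_cast Nat.choose_pos hk
    have hle : |∑ K ∈ B.powersetCard k, (MvPolynomial.eval
        (fun i => if i ∈ B → i ∈ K then (1 : ℝ) else 0) p - 1)| ≤
        ∑ K ∈ B.powersetCard k, (1 / 3 : ℝ) := by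
      refine (Finset.abs_sum_le_sum_abs _ _).trans (Finset.sum_le_sum fun K hK => ?_)
      obtain ⟨hKB, hKk⟩ := Finset.mem_powersetCard.1 hK
      have := hp (fun i => decide (i ∈ B → i ∈ K))
      rw [if_pos ((hf K hKB).2 (Finset.card_pos.1 (by omega))), abs_sub_comm] at this
      simpa only [decide_eq_true_eq] using this
    rw [Finset.sum_sub_distrib, ← h, Finset.sum_const, Finset.sum_const,
      Finset.card_powersetCard, nsmul_eq_mul, nsmul_eq_mul, ← mul_sub, abs_mul,
      abs_of_pos hpos] at hle
    exact le_of_mul_le_mul_left hle hpos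

/-- The edges of an `m × (n + 1 - m)` block of `K_{n,n}`. -/
def edgeBlock (n m : ℕ) : Finset (Fin n × Fin n) :=
  {e | (e.1 : ℕ) < m ∧ (e.2 : ℕ) < n + 1 - m}

lemma le_card_edgeBlock {n m : ℕ} (hm : 2 * m ≤ n + 1) : m ^ 2 ≤ (edgeBlock n m).card := by
  rcases Nat.eq_zero_or_pos m with rfl | hm0
  · simp
  have hmn : m ≤ n := by omega
  have : (Finset.univ.map ((Fin.castLEEmb hmn).prodMap (Fin.castLEEmb hmn))) ⊆
      edgeBlock n m := by
    intro e he
    obtain ⟨⟨i, j⟩, -, rfl⟩ := Finset.mem_map.1 he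
    simp [edgeBlock]
    omega
  simpa [sq] using Finset.card_le_card this

/-- On the edges of the block, with all other edges present, perfect matching is OR. -/
lemma BPM_edgeBlock_iff {n m : ℕ} (hm : 1 ≤ m) (hmn : m ≤ n) {K : Finset (Fin n × Fin n)}
    (hK : K ⊆ edgeBlock n m) :
    BPM n (fun e => decide (e ∈ edgeBlock n m → e ∈ K)) = true ↔ K.Nonempty := by
  simp only [BPM, decide_eq_true_eq]
  constructor
  · rintro ⟨σ, hσ⟩
    by_contra hne
    rw [Finset.not_nonempty_iff_eq_empty] at hne
    subst hne
    have h1 : ∀ i : Fin n, (i : ℕ) < m → n + 1 - m ≤ (σ i : ℕ) := by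
      intro i hi
      have := hσ i
      simp only [edgeBlock, Finset.mem_filter, Finset.mem_univ, true_and, Finset.notMem_empty,
        imp_false, not_and, not_lt] at this
      exact this hi
    have h2 := Fintype.card_le_of_injective
      (fun i : Fin m => (⟨(σ (Fin.castLE hmn i) : ℕ) - (n + 1 - m), by
        have := h1 (Fin.castLE hmn i) (by simp)
        have := (σ (Fin.castLE hmn i)).isLt
        omega⟩ : Fin (m - 1))) (by
        intro i j hij
        have hi := h1 (Fin.castLE hmn i) (by simp)
        have hj := h1 (Fin.castLE hmn j) (by simp)
        simp only [Fin.mk.injEq] at hij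
        have : σ (Fin.castLE hmn i) = σ (Fin.castLE hmn j) := Fin.ext (by omega)
        simpa using σ.injective this)
    simp only [Fintype.card_fin] at h2
    omega
  · rintro ⟨⟨a, b⟩, hab⟩
    have hblock := hK hab
    simp only [edgeBlock, Finset.mem_filter, Finset.mem_univ, true_and] at hblock
    let r : Fin n := ⟨m - 1, by omega⟩
    let c : Fin n := ⟨n - m, by omega⟩
    have hrc : Fin.revPerm r = c := Fin.ext (by simp [r, c, Fin.val_rev]; omega)
    refine ⟨(Equiv.swap a r).trans (Fin.revPerm.trans (Equiv.swap c b)), fun i hi => ?_⟩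
    simp only [edgeBlock, Finset.mem_filter, Finset.mem_univ, true_and, Equiv.trans_apply] at hi ⊢
    by_cases hia : i = a
    · subst hia
      rwa [Equiv.swap_apply_left, hrc, Equiv.swap_apply_left]
    · exfalso
      have key : ∀ j : Fin n, (j : ℕ) < m - 1 →
          n + 1 - m ≤ (Equiv.swap c b (Fin.revPerm j) : ℕ) := by
        intro j hj
        have hv : n + 1 - m ≤ (Fin.revPerm j : ℕ) := by
          simp [Fin.val_rev]; omega
        rwa [Equiv.swap_apply_of_ne_of_ne]
        · intro h; rw [h] at hv; simp [c] at hv; omega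
        · intro h; rw [h] at hv; omega
      have : ((Equiv.swap a r i : Fin n) : ℕ) < m - 1 := by
        by_cases hir : i = r
        · subst hir
          rw [Equiv.swap_apply_right]
          have : (a : ℕ) ≠ r := fun h => hia (Fin.ext h.symm)
          simp only [r] at this
          omega
        · rw [Equiv.swap_apply_of_ne_of_ne hia hir]
          have : (i : ℕ) ≠ r := fun h => hir (Fin.ext h)
          simp only [r] at this
          omega
      have := key _ this
      omega

/-- Every Boolean function on finitely many variables is computed exactly by a polynomial. -/
lemma exists_eval_eq_ite {ι : Type*} [Fintype ι] (f : (ι → Bool) → Bool) :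
    ∃ p : MvPolynomial ι ℝ, ∀ x : ι → Bool,
      MvPolynomial.eval (fun i => if x i then (1 : ℝ) else 0) p = if f x then 1 else 0 := by
  classical
  refine ⟨∑ y : ι → Bool, MvPolynomial.C (if f y then (1 : ℝ) else 0) *
    ∏ i, (if y i then MvPolynomial.X i else 1 - MvPolynomial.X i), fun x => ?_⟩
  rw [map_sum, Finset.sum_eq_single x]
  · rw [map_mul, MvPolynomial.eval_C, map_prod, Finset.prod_eq_one, mul_one]
    intro i _
    cases h : x i <;> simp [h]
  · intro y _ hy
    obtain ⟨i, hi⟩ := Function.ne_iff.1 hy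
    rw [map_mul, map_prod, Finset.prod_eq_zero (Finset.mem_univ i), mul_zero]
    cases h : x i <;> cases h' : y i <;> simp_all
  · simp

/-- For every `n ≥ 1`: `deg̃_{1/3}(BPM_n) ≥ (1/√6) · (⌊(n−1)/2⌋ + 1)`. -/
theorem apxDeg_BPM_lower (n : ℕ) (hn : 1 ≤ n) :
    (1 / Real.sqrt 6) * ((((n - 1) / 2 : ℕ) : ℝ) + 1) ≤
      (apxDeg (Fin n × Fin n) (BPM n) (1 / 3) : ℝ) := by
  obtain ⟨p, hpd, hp⟩ : ∃ p : MvPolynomial (Fin n × Fin n) ℝ,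
      p.totalDegree = apxDeg (Fin n × Fin n) (BPM n) (1 / 3) ∧ ∀ x : Fin n × Fin n → Bool,
        |(if BPM n x then (1 : ℝ) else 0) -
          MvPolynomial.eval (fun i => if x i then (1 : ℝ) else 0) p| ≤ 1 / 3 := by
    refine Nat.sInf_mem (s := {d : ℕ | ∃ p : MvPolynomial (Fin n × Fin n) ℝ, p.totalDegree = d ∧
      ∀ x : Fin n × Fin n → Bool, |(if BPM n x then (1 : ℝ) else 0) -
        MvPolynomial.eval (fun i => if x i then (1 : ℝ) else 0) p| ≤ 1 / 3}) ?_
    obtain ⟨p, hp⟩ := exists_eval_eq_ite (BPM n)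
    exact ⟨_, p, rfl, fun x => by rw [hp, sub_self, abs_zero]; norm_num⟩
  rw [← hpd]
  set m := (n - 1) / 2 + 1 with hm
  have hcard := le_card_edgeBlock (n := n) (m := m) (by omega)
  have hdeg := card_le_six_mul_totalDegree_sq (f := BPM n) (B := edgeBlock n m)
    (Finset.card_pos.1 (lt_of_lt_of_le (by positivity) hcard))
    (fun K hK => BPM_edgeBlock_iff (by omega) (by omega) hK) hp
  have hsq : ((m : ℕ) : ℝ) ^ 2 ≤ 6 * (p.totalDegree : ℝ) ^ 2 := by
    exact_mod_cast hcard.trans hdeg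
  have hmcast : (((n - 1) / 2 : ℕ) : ℝ) + 1 = (m : ℝ) := by rw [hm]; push_cast; rfl
  rw [hmcast, one_div, inv_mul_le_iff₀ (by positivity)]
  refine le_of_sq_le_sq ?_ (by positivity)
  rw [mul_pow, Real.sq_sqrt (by norm_num)]
  exact hsq
end
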